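/- arXiv:1111.1538 — 2 statements merged into one kernel-verified Lean document; each statement's English description precedes it below -/
import Mathlib

section
/- Assume the amalgam setting: groups (G_λ, d_λ) with two-sided invariant metrics, a group A with injective homomorphisms φ_λ : A → G_λ having closed images and with d_{λ₁}(φ_{λ₁}(a), φ_{λ₁}(a')) = d_{λ₂}(φ_{λ₂}(a), φ_{λ₂}(a')) for all a, a' ∈ A, λ₁, λ₂. For each λ let H_λ ≤ G_λ be a subgroup with φ_λ(A) ≤ H_λ, equipped with the restricted metric d_λ|_{H_λ}. Let Φ : ∐_A H_λ → ∐_A G_λ be the canonical homomorphism induced by the inclusions H_λ ↪ G_λ (Φ is injective). Then: (a) the Graev metric on ∐_A H_λ equals the pullback along Φ of the Graev metric d̄ on ∐_A G_λ, i.e. d̄_H(x, y) = d̄(Φ(x), Φ(y)) for all x, y ∈ ∐_A H_λ; and (b) if moreover each H_λ is closed in (G_λ, d_λ), then the image of Φ is a closed subset of (∐_A G_λ, d̄). -/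
/-- A two-sided invariant metric on a group. -/
def IsTSIMetric {G : Type*} [Group G] (d : G → G → ℝ) : Prop :=
  (∀ x y : G, d x y = 0 ↔ x = y) ∧
  (∀ x y : G, d x y = d y x) ∧
  (∀ x y z : G, d x z ≤ d x y + d y z) ∧
  (∀ g x y : G, d (g * x) (g * y) = d x y) ∧
  (∀ g x y : G, d (x * g) (y * g) = d x y)

/-- A set is closed with respect to the metric `d`. -/
def IsDClosed {G : Type*} (d : G → G → ℝ) (S : Set G) : Prop :=
  ∀ x : G, (∀ ε : ℝ, 0 < ε → ∃ s ∈ S, d x s < ε) → x ∈ S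

/-- A metric on the amalgamated free product extends the amalgam metric: it restricts to `d λ`
on each factor and realizes the amalgam distance between elements of distinct factors. -/
def ExtendsAmalgamMetric {Λ : Type*} {G : Λ → Type*} [∀ l, Group (G l)]
    {A : Type*} [Group A] (φ : ∀ l, A →* G l) (d : ∀ l, G l → G l → ℝ)
    (dbar : Monoid.PushoutI φ → Monoid.PushoutI φ → ℝ) : Prop :=
  (∀ (l : Λ) (g h : G l),
    dbar (Monoid.PushoutI.of (φ := φ) l g) (Monoid.PushoutI.of (φ := φ) l h) = d l g h) ∧
  (∀ (l₁ l₂ : Λ), l₁ ≠ l₂ → ∀ (g₁ : G l₁) (g₂ : G l₂),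
    dbar (Monoid.PushoutI.of (φ := φ) l₁ g₁) (Monoid.PushoutI.of (φ := φ) l₂ g₂)
      = ⨅ a : A, (d l₁ g₁ (φ l₁ a) + d l₂ (φ l₂ a) g₂))

namespace IsTSIMetric

variable {G : Type*} [Group G] {d : G → G → ℝ}

lemma self_eq_zero (h : IsTSIMetric d) (x : G) : d x x = 0 := (h.1 x x).2 rfl

lemma nonneg (h : IsTSIMetric d) (x y : G) : 0 ≤ d x y := by
  have := h.2.2.1 x y x
  rw [h.self_eq_zero, h.2.1 y x] at this
  linarith

lemma mul_mul_le (h : IsTSIMetric d) (x y z t : G) : d (x * y) (z * t) ≤ d x z + d y t := by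
  have := h.2.2.1 (x * y) (z * y) (z * t)
  rwa [h.2.2.2.2, h.2.2.2.1] at this

lemma inv_mul_right (h : IsTSIMetric d) (x y z : G) : d y (x⁻¹ * z) = d (x * y) z := by
  rw [← h.2.2.2.1 x, mul_inv_cancel_left]

lemma mul_inv_right (h : IsTSIMetric d) (x y z : G) : d y (z * x⁻¹) = d (y * x) z := by
  rw [← h.2.2.2.2 x, inv_mul_cancel_right]

end IsTSIMetric

namespace Amalgam

open Monoid Monoid.PushoutI

section Words

variable {Λ : Type*} {G : Λ → Type*} [∀ l, Group (G l)] {A : Type*} [Group A]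
  (φ : ∀ l, A →* G l)

/-- The product of a word in the amalgamated free product. -/
def wordProd (Z : List (Σ l, G l)) : PushoutI φ := (Z.map fun x => of x.1 x.2).prod

@[simp] lemma wordProd_nil : wordProd φ [] = 1 := rfl

@[simp] lemma wordProd_cons (x : Σ l, G l) (Z : List (Σ l, G l)) :
    wordProd φ (x :: Z) = of x.1 x.2 * wordProd φ Z := by simp [wordProd]

@[simp] lemma wordProd_append (Z W : List (Σ l, G l)) :
    wordProd φ (Z ++ W) = wordProd φ Z * wordProd φ W := by simp [wordProd]

/-- Adjacent letters lie in different factors, and no letter lies in the amalgamated subgroup. -/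
def IsReduced (Z : List (Σ l, G l)) : Prop :=
  (Z.map Sigma.fst).IsChain (· ≠ ·) ∧ ∀ x ∈ Z, x.2 ∉ (φ x.1).range

/-- Two letters whose product is visibly a single letter. -/
def Contractible (x y : Σ l, G l) : Prop :=
  x.1 = y.1 ∨ x.2 ∈ (φ x.1).range ∨ y.2 ∈ (φ y.1).range

variable {φ}

lemma exists_contractible {X : Type*} (f : X → Σ l, G l) {w : List X} (hw : 2 ≤ w.length)
    (h : ¬ IsReduced φ (w.map f)) :
    ∃ u x y v, w = u ++ x :: y :: v ∧ Contractible φ (f x) (f y) := by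
  by_contra! hc
  refine h ⟨?_, ?_⟩
  · rw [List.map_map, List.isChain_map, List.isChain_iff_forall_rel_of_append_cons_cons]
    intro x y u v e hxy
    exact hc u x y v e (Or.inl hxy)
  · simp only [List.mem_map, forall_exists_index, and_imp, forall_apply_eq_imp_iff₂]
    intro x hx hA
    obtain ⟨u, v, rfl⟩ := List.append_of_mem hx
    rcases v with _ | ⟨y, v⟩
    · rcases List.eq_nil_or_concat' u with rfl | ⟨u, y, rfl⟩
      · simp at hw
      · exact hc u y x [] (by simp) (Or.inr (Or.inr hA))
    · exact hc u x y v rfl (Or.inr (Or.inl hA))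

lemma IsReduced.eq_nil (hinj : ∀ l, Function.Injective (φ l)) {Z : List (Σ l, G l)}
    (hZ : IsReduced φ Z) (h : wordProd φ Z ∈ (base φ).range) : Z = [] := by
  let w : CoprodI.Word G :=
    { toList := Z
      ne_one := fun x hx e => hZ.2 x hx (e ▸ one_mem _)
      chain_ne := (List.isChain_map _).1 hZ.1 }
  have hw : Reduced φ w := hZ.2
  have := hw.eq_empty_of_mem_range hinj (by
    simpa [w, CoprodI.Word.prod, wordProd, map_list_prod, Function.comp_def] using h)
  simpa [w, CoprodI.Word.empty] using congrArg CoprodI.Word.toList this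

lemma IsReduced.tail {x : Σ l, G l} {Z : List (Σ l, G l)} (h : IsReduced φ (x :: Z)) :
    IsReduced φ Z :=
  ⟨h.1.tail, fun y hy => h.2 y (List.mem_cons_of_mem _ hy)⟩

lemma isReduced_append_cons {u v : List (Σ l, G l)} {x y : Σ l, G l} (hxy : x.1 = y.1)
    (hu : IsReduced φ (u ++ [x])) (hv : IsReduced φ (y :: v)) (z : G x.1)
    (hz : z ∉ (φ x.1).range) : IsReduced φ (u ++ ⟨x.1, z⟩ :: v) := by
  refine ⟨?_, ?_⟩
  · have h1 := hu.1
    have h2 := hv.1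
    simp only [List.map_append, List.map_cons, List.map_nil] at h1 h2 ⊢
    exact List.isChain_split.2 ⟨h1, hxy ▸ h2⟩
  · intro t ht
    simp only [List.mem_append, List.mem_cons] at ht
    rcases ht with ht | rfl | ht
    · exact hu.2 t (by simp [ht])
    · exact hz
    · exact hv.2 t (by simp [ht])

lemma IsReduced.append {u v : List (Σ l, G l)} {x y : Σ l, G l} (hxy : x.1 ≠ y.1)
    (hu : IsReduced φ (u ++ [x])) (hv : IsReduced φ (y :: v)) :
    IsReduced φ (u ++ x :: y :: v) := by
  have hx : x.2 ∉ (φ x.1).range := hu.2 x (by simp)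
  refine isReduced_append_cons rfl hu ⟨?_, ?_⟩ x.2 hx
  · have := hv.1
    simp only [List.map_cons] at this ⊢
    exact List.IsChain.cons_cons hxy this
  · intro z hz
    rcases List.mem_cons.1 hz with rfl | hz
    · exact hx
    · exact hv.2 _ hz

/-- The formal inverse of a word. -/
def wordInv (Z : List (Σ l, G l)) : List (Σ l, G l) := (Z.map fun x => ⟨x.1, x.2⁻¹⟩).reverse

lemma wordInv_cons (x : Σ l, G l) (Z : List (Σ l, G l)) :
    wordInv (x :: Z) = wordInv Z ++ [⟨x.1, x.2⁻¹⟩] := by simp [wordInv]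

lemma wordProd_wordInv (Z : List (Σ l, G l)) : wordProd φ (wordInv Z) = (wordProd φ Z)⁻¹ := by
  induction Z with
  | nil => simp [wordInv]
  | cons x Z ih => simp [wordInv_cons, ih]

lemma IsReduced.wordInv {Z : List (Σ l, G l)} (h : IsReduced φ Z) :
    IsReduced φ (wordInv Z) := by
  refine ⟨?_, ?_⟩
  · have h1 := h.1
    simp only [Amalgam.wordInv, List.map_reverse, List.map_map, List.isChain_reverse]
    refine (List.IsChain.imp ?_ h1 :)
    intro a b hab
    exact hab.symm
  · intro x hx
    simp only [Amalgam.wordInv, List.mem_reverse, List.mem_map] at hx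
    obtain ⟨y, hy, rfl⟩ := hx
    simpa using h.2 y hy

/-- Reduced words with the same product up to the amalgamated subgroup have first letters in the
same double coset. -/
lemma head_eq_of_prod_eq (hinj : ∀ l, Function.Injective (φ l)) {x y : Σ l, G l}
    {P Q : List (Σ l, G l)} (hP : IsReduced φ (x :: P)) (hQ : IsReduced φ (y :: Q)) (a : A)
    (h : wordProd φ (x :: P) = base φ a * wordProd φ (y :: Q)) :
    ∃ a', x = ⟨y.1, φ y.1 a * y.2 * φ y.1 a'⟩ := by
  have hQi := hQ.wordInv
  rw [wordInv_cons] at hQi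
  obtain ⟨l, s⟩ := x
  obtain ⟨m, t⟩ := y
  simp only [wordProd_cons] at h
  by_cases hlm : l = m
  · subst hlm
    by_cases hk : t⁻¹ * φ l a⁻¹ * s ∈ (φ l).range
    · obtain ⟨a', ha'⟩ := hk
      refine ⟨a', ?_⟩
      simp only [ha', map_inv]
      group
    · exfalso
      have hr := isReduced_append_cons (x := ⟨l, t⁻¹⟩) (y := ⟨l, s⟩) rfl hQi hP _ hk
      have := hr.eq_nil hinj ⟨1, by
        simp only [wordProd_append, wordProd_cons, wordProd_wordInv, map_mul, mul_assoc, h,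
          map_inv, map_one, of_apply_eq_base]
        group⟩
      simp at this
  · exfalso
    have hk : t⁻¹ * φ m a⁻¹ ∉ (φ m).range := fun hk =>
      hQ.2 ⟨m, t⟩ (by simp) (by
        have := mul_mem hk ((φ m).mem_range.2 ⟨a, rfl⟩)
        simpa using this)
    have hQi' := isReduced_append_cons (y := ⟨m, t⁻¹⟩) rfl hQi
      (v := []) ⟨by simp, fun z hz => hQi.2 z (by simp_all)⟩ _ hk
    have hr := hQi'.append (Ne.symm hlm) hP
    have := hr.eq_nil hinj ⟨1, by
      simp only [wordProd_append, wordProd_cons, wordProd_wordInv, map_mul, mul_assoc, h,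
        map_inv, map_one, of_apply_eq_base]
      group⟩
    simp at this

lemma Contractible.exists_letter {x y : Σ l, G l} (h : Contractible φ x y)
    (K : ∀ l, Subgroup (G l)) (hK : ∀ l a, φ l a ∈ K l) :
    ∃ z : Σ l, G l, (of z.1 z.2 : PushoutI φ) = of x.1 x.2 * of y.1 y.2 ∧
      (x.2 ∈ K x.1 → y.2 ∈ K y.1 → z.2 ∈ K z.1) := by
  obtain ⟨l, s⟩ := x
  obtain ⟨m, t⟩ := y
  rcases h with h | ⟨a, ha⟩ | ⟨a, ha⟩
  · obtain rfl : l = m := h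
    exact ⟨⟨l, s * t⟩, by simp, mul_mem⟩
  · obtain rfl : φ l a = s := ha
    exact ⟨⟨m, φ m a * t⟩, by simp [of_apply_eq_base], fun _ => mul_mem (hK m a)⟩
  · obtain rfl : φ m a = t := ha
    exact ⟨⟨l, s * φ l a⟩, by simp [of_apply_eq_base], fun hs _ => mul_mem hs (hK l a)⟩

/-- Every word with letters in subgroups containing the amalgamated one can be shortened, within
these subgroups, to a reduced word or a word of length at most one. -/
lemma exists_reduced (K : ∀ l, Subgroup (G l)) (hK : ∀ l a, φ l a ∈ K l) (n : ℕ) :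
    ∀ Z : List (Σ l, G l), Z.length ≤ n → (∀ x ∈ Z, x.2 ∈ K x.1) →
      ∃ W : List (Σ l, G l), wordProd φ W = wordProd φ Z ∧ (∀ x ∈ W, x.2 ∈ K x.1) ∧
        W.length ≤ Z.length ∧ (W.length ≤ 1 ∨ IsReduced φ W) := by
  induction n with
  | zero => exact fun Z hZ hm => ⟨Z, rfl, hm, le_rfl, Or.inl (by omega)⟩
  | succ n ih =>
    intro Z hZ hm
    by_cases hred : IsReduced φ Z
    · exact ⟨Z, rfl, hm, le_rfl, Or.inr hred⟩
    by_cases h1 : Z.length ≤ 1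
    · exact ⟨Z, rfl, hm, le_rfl, Or.inl h1⟩
    obtain ⟨u, x, y, v, rfl, hxy⟩ :=
      exists_contractible (φ := φ) id (w := Z) (by omega) (by simpa using hred)
    obtain ⟨z, hz, hzK⟩ := hxy.exists_letter K hK
    obtain ⟨W, hW, hWK, hWl, hW1⟩ := ih (u ++ z :: v) (by simp at hZ ⊢; omega) (by
      intro t ht
      simp only [List.mem_append, List.mem_cons] at ht
      rcases ht with ht | rfl | ht
      · exact hm t (by simp [ht])
      · exact hzK (hm x (by simp)) (hm y (by simp))
      · exact hm t (by simp [ht]))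
    exact ⟨W, by simp [hW, hz, mul_assoc], hWK, hWl.trans (by simp), hW1⟩

end Words

section Pairs

variable {Λ : Type*} {G : Λ → Type*}

/-- The first letter of a pair of letters from the same factor. -/
def fstLetter (x : Σ l, G l × G l) : Σ l, G l := ⟨x.1, x.2.1⟩

/-- The second letter of a pair of letters from the same factor. -/
def sndLetter (x : Σ l, G l × G l) : Σ l, G l := ⟨x.1, x.2.2⟩

/-- The letterwise distance between the two words given by a list of pairs. -/
def cost (d : ∀ l, G l → G l → ℝ) (w : List (Σ l, G l × G l)) : ℝ :=
  (w.map fun x => d x.1 x.2.1 x.2.2).sum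

variable {d : ∀ l, G l → G l → ℝ}

@[simp] lemma cost_nil : cost d [] = 0 := rfl

@[simp] lemma cost_cons (x : Σ l, G l × G l) (w : List (Σ l, G l × G l)) :
    cost d (x :: w) = d x.1 x.2.1 x.2.2 + cost d w := by simp [cost]

@[simp] lemma cost_append (w w' : List (Σ l, G l × G l)) :
    cost d (w ++ w') = cost d w + cost d w' := by simp [cost]

lemma eq_of_fstLetter_eq {x z : Σ l, G l × G l} (h : fstLetter x = fstLetter z) :
    ∃ t, x = ⟨z.1, z.2.1, t⟩ := by
  obtain ⟨l, s, t⟩ := x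
  obtain ⟨m, s', t'⟩ := z
  simp only [fstLetter, Sigma.mk.injEq] at h
  obtain ⟨rfl, h⟩ := h
  exact ⟨t, by simpa using h⟩

variable [∀ l, Group (G l)]

lemma cost_nonneg (hd : ∀ l, IsTSIMetric (d l)) (w : List (Σ l, G l × G l)) : 0 ≤ cost d w := by
  refine List.sum_nonneg fun r hr => ?_
  obtain ⟨x, -, rfl⟩ := List.mem_map.1 hr
  exact (hd _).nonneg _ _

variable {A : Type*} [Group A] {φ : ∀ l, A →* G l}

/-- Two adjacent pairs whose second letters are contractible can be contracted to one pair `z`,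
and every change of the second letter of `z` can be distributed over the two original pairs. -/
lemma exists_contraction (hd : ∀ l, IsTSIMetric (d l))
    (K : ∀ l, Subgroup (G l)) (hK : ∀ l a, φ l a ∈ K l)
    {x y : Σ l, G l × G l} (h : Contractible φ (sndLetter x) (sndLetter y)) :
    ∃ (z : Σ l, G l × G l) (c : ℝ), 0 ≤ c ∧
      (of z.1 z.2.2 : PushoutI φ) = of x.1 x.2.2 * of y.1 y.2.2 ∧
      d z.1 z.2.1 z.2.2 + c ≤ d x.1 x.2.1 x.2.2 + d y.1 y.2.1 y.2.2 ∧
      (x.2.1 ∈ K x.1 → y.2.1 ∈ K y.1 → z.2.1 ∈ K z.1) ∧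
      ∀ t, ∃ t₁ t₂, (of x.1 t₁ * of y.1 t₂ : PushoutI φ) = of z.1 t ∧
        d x.1 x.2.1 t₁ + d y.1 y.2.1 t₂ ≤ d z.1 z.2.1 t + c ∧
        (x.2.1 ∈ K x.1 → y.2.1 ∈ K y.1 → t ∈ K z.1 → t₁ ∈ K x.1 ∧ t₂ ∈ K y.1) := by
  obtain ⟨l, s, t⟩ := x
  obtain ⟨m, s', t'⟩ := y
  simp only [sndLetter, Contractible] at h
  rcases h with h | ⟨a, ha⟩ | ⟨a, ha⟩
  · obtain rfl : l = m := h
    refine ⟨⟨l, s * s', t * t'⟩, 0, le_rfl, by simp, ?_, mul_mem, fun r => ?_⟩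
    · simpa using (hd l).mul_mul_le s s' t t'
    · refine ⟨s, s⁻¹ * r, by simp, ?_, fun hs _ hr => ⟨hs, mul_mem (inv_mem hs) hr⟩⟩
      simp [(hd l).self_eq_zero, (hd l).inv_mul_right]
  · obtain rfl : φ l a = t := ha
    refine ⟨⟨m, φ m a * s', φ m a * t'⟩, d l s (φ l a), (hd l).nonneg _ _,
      by simp [of_apply_eq_base], ?_, fun _ => mul_mem (hK m a), fun r => ?_⟩
    · simp only [(hd m).2.2.2.1]
      linarith
    · refine ⟨φ l a, (φ m a)⁻¹ * r, by simp [of_apply_eq_base], ?_,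
        fun _ _ hr => ⟨hK l a, mul_mem (inv_mem (hK m a)) hr⟩⟩
      simp only [(hd m).inv_mul_right]
      linarith
  · obtain rfl : φ m a = t' := ha
    refine ⟨⟨l, s * φ l a, t * φ l a⟩, d m s' (φ m a), (hd m).nonneg _ _,
      by simp [of_apply_eq_base], ?_, fun hs _ => mul_mem hs (hK l a), fun r => ?_⟩
    · simp only [(hd l).2.2.2.2]
      linarith
    · refine ⟨r * (φ l a)⁻¹, φ m a, by simp [of_apply_eq_base], ?_,
        fun _ _ hr => ⟨mul_mem hr (inv_mem (hK l a)), hK m a⟩⟩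
      simp only [(hd l).mul_inv_right]
      linarith

/-- A trivial second word can be kept trivial while replacing it by a word with letters in any
subgroups containing the letters of the first word. -/
lemma exists_mem_subgroup (hd : ∀ l, IsTSIMetric (d l)) (hinj : ∀ l, Function.Injective (φ l))
    (K : ∀ l, Subgroup (G l)) (hK : ∀ l a, φ l a ∈ K l) (n : ℕ) :
    ∀ w : List (Σ l, G l × G l), w.length ≤ n → (∀ x ∈ w, x.2.1 ∈ K x.1) →
      wordProd φ (w.map sndLetter) = 1 →
      ∃ w' : List (Σ l, G l × G l), w'.map fstLetter = w.map fstLetter ∧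
        (∀ x ∈ w', x.2.1 ∈ K x.1 ∧ x.2.2 ∈ K x.1) ∧ wordProd φ (w'.map sndLetter) = 1 ∧
        cost d w' ≤ cost d w := by
  induction n with
  | zero =>
    intro w hw hwK h1
    obtain rfl := List.length_eq_zero_iff.1 (Nat.le_zero.1 hw)
    exact ⟨[], rfl, by simp, rfl, le_rfl⟩
  | succ n ih =>
    intro w hw hwK h1
    by_cases hlen : w.length ≤ 1
    · rcases w with _ | ⟨x, _ | ⟨y, w⟩⟩
      · exact ⟨[], rfl, by simp, rfl, le_rfl⟩
      · have hx : x.2.2 = 1 := of_injective hinj x.1 (by simpa [sndLetter] using h1)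
        exact ⟨[x], rfl, by simpa [hx] using hwK, h1, le_rfl⟩
      · simp at hlen
    obtain ⟨u, x, y, v, rfl, hxy⟩ := exists_contractible (φ := φ) sndLetter (w := w) (by omega)
      fun hred => by
        have := hred.eq_nil hinj (h1 ▸ one_mem _)
        simp at this
        simp [this] at hlen
    obtain ⟨z, c, hc, hz, hzc, hzK, hz'⟩ := exists_contraction hd K hK hxy
    have hxK := hwK x (by simp)
    have hyK := hwK y (by simp)
    obtain ⟨w', hw', hw'K, hw'1, hw'c⟩ := ih (u ++ z :: v) (by simp at hw ⊢; omega) (by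
        intro t ht
        simp only [List.mem_append, List.mem_cons] at ht
        rcases ht with ht | rfl | ht
        · exact hwK t (by simp [ht])
        · exact hzK hxK hyK
        · exact hwK t (by simp [ht])) (by
        simpa [sndLetter, hz, mul_assoc] using h1)
    rw [List.map_append, List.map_cons, List.map_eq_append_iff] at hw'
    obtain ⟨u', v', rfl, hu', hv'⟩ := hw'
    obtain ⟨z', v', rfl, hzz, hv''⟩ := List.map_eq_cons_iff.1 hv'
    obtain ⟨t, rfl⟩ := eq_of_fstLetter_eq hzz
    obtain ⟨t₁, t₂, ht, htc, htK⟩ := hz' t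
    refine ⟨u' ++ ⟨x.1, x.2.1, t₁⟩ :: ⟨y.1, y.2.1, t₂⟩ :: v', ?_, ?_, ?_, ?_⟩
    · simp [hu', hv'', fstLetter]
    · intro r hr
      have := htK hxK hyK (hw'K ⟨z.1, z.2.1, t⟩ (by simp)).2
      simp only [List.mem_append, List.mem_cons] at hr
      rcases hr with hr | rfl | rfl | hr
      · exact hw'K r (by simp [hr])
      · exact ⟨hxK, this.1⟩
      · exact ⟨hyK, this.2⟩
      · exact hw'K r (by simp [hr])
    · rw [← hw'1]
      simp [sndLetter, ← ht, mul_assoc]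
    · simp at hw'c hzc htc ⊢
      linarith

/-- In a pair of words with trivial second word, the second letter of the first pair can be chosen
in the amalgamated subgroup or equal to the first letter. -/
lemma exists_pinned_head (hd : ∀ l, IsTSIMetric (d l)) (hinj : ∀ l, Function.Injective (φ l))
    (n : ℕ) :
    ∀ (x : Σ l, G l × G l) (v : List (Σ l, G l × G l)), v.length ≤ n →
      wordProd φ ((x :: v).map sndLetter) = 1 →
      ∃ (t : G x.1) (v' : List (Σ l, G l × G l)), v'.map fstLetter = v.map fstLetter ∧
        of x.1 t * wordProd φ (v'.map sndLetter) = 1 ∧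
        d x.1 x.2.1 t + cost d v' ≤ d x.1 x.2.1 x.2.2 + cost d v ∧
        (t ∈ (φ x.1).range ∨ t = x.2.1) := by
  induction n with
  | zero =>
    intro x v hv h1
    obtain rfl := List.length_eq_zero_iff.1 (Nat.le_zero.1 hv)
    have hx : x.2.2 = 1 := of_injective hinj x.1 (by simpa [sndLetter] using h1)
    exact ⟨x.2.2, [], rfl, by simpa [sndLetter] using h1, le_rfl, Or.inl (hx ▸ one_mem _)⟩
  | succ n ih =>
    intro x v hv h1
    by_cases hA : x.2.2 ∈ (φ x.1).range
    · exact ⟨x.2.2, v, rfl, by simpa [sndLetter] using h1, le_rfl, Or.inl hA⟩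
    have hlen : 2 ≤ (x :: v).length := by
      rcases v with _ | ⟨y, v⟩
      · have hx : x.2.2 = 1 := of_injective hinj x.1 (by simpa [sndLetter] using h1)
        exact absurd (hx ▸ one_mem _) hA
      · simp
    obtain ⟨u, p, q, r, e, hpq⟩ := exists_contractible (φ := φ) sndLetter hlen
      fun hred => by simpa using hred.eq_nil hinj (h1 ▸ one_mem _)
    rcases u with _ | ⟨x', u⟩
    · obtain ⟨rfl, rfl⟩ : x = p ∧ v = q :: r := by simpa using e
      obtain ⟨l, s, t⟩ := x
      obtain ⟨m, s', t'⟩ := q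
      simp only [sndLetter, Contractible] at hpq
      rcases hpq with h | h | ⟨a, ha⟩
      · obtain rfl : l = m := h
        refine ⟨s, ⟨l, s', s⁻¹ * (t * t')⟩ :: r, by simp [fstLetter], ?_, ?_, Or.inr rfl⟩
        · simpa [sndLetter, mul_assoc] using h1
        · have := (hd l).mul_mul_le s s' t t'
          simp [(hd l).self_eq_zero, (hd l).inv_mul_right]
          linarith
      · exact absurd h hA
      · obtain rfl : φ m a = t' := ha
        obtain ⟨t₁, v', hv', h1', hc', ht⟩ := ih ⟨l, s * φ l a, t * φ l a⟩ r
          (by simpa using hv)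
          (by simpa [sndLetter, mul_assoc, of_apply_eq_base] using h1)
        simp only at t₁ h1' hc' ht
        refine ⟨t₁ * (φ l a)⁻¹, ⟨m, s', φ m a⟩ :: v', by simp [fstLetter, hv'], ?_, ?_, ?_⟩
        · simpa [sndLetter, mul_assoc, of_apply_eq_base] using h1'
        · simp only [(hd l).2.2.2.2] at hc'
          simp only [(hd l).mul_inv_right, cost_cons]
          linarith
        · rcases ht with ht | rfl
          · exact Or.inl (mul_mem ht (inv_mem ⟨a, rfl⟩))
          · exact Or.inr (by simp)
    · obtain ⟨rfl, rfl⟩ : x = x' ∧ v = u ++ p :: q :: r := by simpa using e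
      obtain ⟨z, c, hc, hz, hzc, -, hz'⟩ :=
        exists_contraction hd (fun _ => ⊤) (fun _ _ => trivial) hpq
      obtain ⟨t, v', hv', h1', hc', ht⟩ := ih x (u ++ z :: r) (by simp at hv ⊢; omega) (by
        simpa [sndLetter, hz, mul_assoc] using h1)
      rw [List.map_append, List.map_cons, List.map_eq_append_iff] at hv'
      obtain ⟨u', v', rfl, hu', hv'⟩ := hv'
      obtain ⟨z', v', rfl, hzz, hv''⟩ := List.map_eq_cons_iff.1 hv'
      obtain ⟨t', rfl⟩ := eq_of_fstLetter_eq hzz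
      obtain ⟨t₁, t₂, ht', htc, -⟩ := hz' t'
      refine ⟨t, u' ++ ⟨p.1, p.2.1, t₁⟩ :: ⟨q.1, q.2.1, t₂⟩ :: v', ?_, ?_, ?_, ht⟩
      · simp [hu', hv'', fstLetter]
      · rw [← h1']
        simp [sndLetter, ← ht', mul_assoc]
      · simp at hc' hzc htc ⊢
        linarith

/-- In a pair of words with trivial second word, any second letter can be chosen in the amalgamated
subgroup or equal to the corresponding first letter. -/
lemma exists_pinned (hd : ∀ l, IsTSIMetric (d l)) (hinj : ∀ l, Function.Injective (φ l))
    (u : List (Σ l, G l × G l)) (x : Σ l, G l × G l) (v : List (Σ l, G l × G l))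
    (h1 : wordProd φ ((u ++ x :: v).map sndLetter) = 1) :
    ∃ (u' : List (Σ l, G l × G l)) (t : G x.1) (v' : List (Σ l, G l × G l)),
      u'.map fstLetter = u.map fstLetter ∧ v'.map fstLetter = v.map fstLetter ∧
      wordProd φ ((u' ++ ⟨x.1, x.2.1, t⟩ :: v').map sndLetter) = 1 ∧
      cost d (u' ++ ⟨x.1, x.2.1, t⟩ :: v') ≤ cost d (u ++ x :: v) ∧
      (t ∈ (φ x.1).range ∨ t = x.2.1) := by
  obtain ⟨t, w, hw, hw1, hwc, ht⟩ := exists_pinned_head hd hinj _ x (v ++ u) le_rfl (by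
    simp only [List.map_append, List.map_cons, wordProd_append, wordProd_cons] at h1 ⊢
    rw [← mul_assoc]
    exact mul_eq_one_symm h1)
  rw [List.map_append, List.map_eq_append_iff] at hw
  obtain ⟨v', u', rfl, hv', hu'⟩ := hw
  refine ⟨u', t, v', hu', hv', ?_, ?_, ht⟩
  · simp only [List.map_append, List.map_cons, wordProd_append, wordProd_cons, sndLetter]
      at hw1 ⊢
    rw [← mul_assoc] at hw1
    exact mul_eq_one_symm hw1
  · simp only [cost_append, cost_cons] at hwc ⊢
    linarith

/-- A pair of words with trivial second word can be replaced by a cheaper one whose first word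
is reduced. -/
lemma exists_isReduced_fst (hd : ∀ l, IsTSIMetric (d l)) (hinj : ∀ l, Function.Injective (φ l))
    (hagree : ∀ (l₁ l₂ : Λ) (a a' : A), d l₁ (φ l₁ a) (φ l₁ a') = d l₂ (φ l₂ a) (φ l₂ a'))
    (n : ℕ) :
    ∀ w : List (Σ l, G l × G l), w.length ≤ n →
      wordProd φ (w.map fstLetter) ∉ (base φ).range → wordProd φ (w.map sndLetter) = 1 →
      ∃ w' : List (Σ l, G l × G l), IsReduced φ (w'.map fstLetter) ∧
        wordProd φ (w'.map fstLetter) = wordProd φ (w.map fstLetter) ∧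
        wordProd φ (w'.map sndLetter) = 1 ∧ cost d w' ≤ cost d w := by
  induction n with
  | zero =>
    intro w hw hb h1
    obtain rfl := List.length_eq_zero_iff.1 (Nat.le_zero.1 hw)
    exact absurd (one_mem _) hb
  | succ n ih =>
    intro w hw hb h1
    by_cases hred : IsReduced φ (w.map fstLetter)
    · exact ⟨w, hred, rfl, h1, le_rfl⟩
    have hlen : 2 ≤ w.length := by
      rcases w with _ | ⟨x, _ | ⟨y, w⟩⟩
      · exact absurd (one_mem _) hb
      · refine absurd ⟨by simp, ?_⟩ hred
        simp only [List.map_cons, List.map_nil, List.mem_singleton, forall_eq]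
        rintro ⟨a, ha⟩
        refine hb ⟨a, ?_⟩
        simp [← ha, of_apply_eq_base]
      · simp
    obtain ⟨u, x, y, v, rfl, hxy⟩ := exists_contractible (φ := φ) fstLetter hlen hred
    suffices h : ∃ (u' : List (Σ l, G l × G l)) (x' y' : Σ l, G l × G l)
        (v' : List (Σ l, G l × G l)),
        (u' ++ x' :: y' :: v').map fstLetter = (u ++ x :: y :: v).map fstLetter ∧
        wordProd φ ((u' ++ x' :: y' :: v').map sndLetter) = 1 ∧
        cost d (u' ++ x' :: y' :: v') ≤ cost d (u ++ x :: y :: v) ∧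
        ∃ z : Σ l, G l × G l,
          (of z.1 z.2.1 : PushoutI φ) = of x'.1 x'.2.1 * of y'.1 y'.2.1 ∧
          (of z.1 z.2.2 : PushoutI φ) = of x'.1 x'.2.2 * of y'.1 y'.2.2 ∧
          d z.1 z.2.1 z.2.2 ≤ d x'.1 x'.2.1 x'.2.2 + d y'.1 y'.2.1 y'.2.2 by
      obtain ⟨u', x', y', v', hfst, hsnd, hc, z, hz1, hz2, hzc⟩ := h
      have hz : wordProd φ ((u' ++ z :: v').map fstLetter) =
          wordProd φ ((u ++ x :: y :: v).map fstLetter) := by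
        rw [← hfst]
        simp [fstLetter, hz1, mul_assoc]
      obtain ⟨w', hw'r, hw'1, hw'2, hw'c⟩ := ih (u' ++ z :: v')
        (by
          have := congrArg List.length hfst
          simp at this hw ⊢
          omega)
        (hz ▸ hb) (by
          rw [← hsnd]
          simp [sndLetter, hz2, mul_assoc])
      refine ⟨w', hw'r, hw'1.trans hz, hw'2, ?_⟩
      simp only [cost_append, cost_cons] at hw'c hc ⊢
      linarith
    obtain ⟨l, s, t⟩ := x
    obtain ⟨m, s', t'⟩ := y
    simp only [fstLetter, Contractible] at hxy
    rcases hxy with h | ⟨a, ha⟩ | ⟨a, ha⟩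
    · obtain rfl : l = m := h
      exact ⟨u, _, _, v, rfl, h1, le_rfl, ⟨l, s * s', t * t'⟩, by simp, by simp,
        (hd l).mul_mul_le s s' t t'⟩
    · obtain rfl : φ l a = s := ha
      obtain ⟨u', r, v', hu', hv', h1', hc', hr⟩ := exists_pinned hd hinj _ _ _ h1
      obtain ⟨y', v', rfl, hy, hv''⟩ := List.map_eq_cons_iff.1 hv'
      obtain ⟨r', rfl⟩ := eq_of_fstLetter_eq hy
      obtain ⟨b, hb'⟩ : ∃ b, φ l b = r := hr.elim id fun h => ⟨a, h.symm⟩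
      refine ⟨u', _, _, v', ?_, h1', hc', ⟨m, φ m a * s', φ m b * r'⟩, ?_, ?_, ?_⟩
      · simp [hu', hv'', fstLetter]
      · simp [of_apply_eq_base]
      · simp [of_apply_eq_base, ← hb']
      · simpa [← hb', hagree l m] using (hd m).mul_mul_le (φ m a) s' (φ m b) r'
    · obtain rfl : φ m a = s' := ha
      obtain ⟨u', r, v', hu', hv', h1', hc', hr⟩ :=
        exists_pinned hd hinj (u ++ [⟨l, s, t⟩]) ⟨m, φ m a, t'⟩ v (by simpa using h1)
      rw [List.map_append, List.map_eq_append_iff] at hu'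
      obtain ⟨u', x', rfl, hu', hx'⟩ := hu'
      obtain ⟨x', rfl, hx''⟩ := List.map_eq_singleton_iff.1 hx'
      obtain ⟨r', rfl⟩ := eq_of_fstLetter_eq hx''
      obtain ⟨b, hb'⟩ : ∃ b, φ m b = r := hr.elim id fun h => ⟨a, h.symm⟩
      refine ⟨u', ⟨l, s, r'⟩, ⟨m, φ m a, r⟩, v', ?_, by simpa using h1', by simpa using hc',
        ⟨l, s * φ l a, r' * φ l b⟩, ?_, ?_, ?_⟩
      · simp [hu', hv', fstLetter]
      · simp [of_apply_eq_base]
      · simp [of_apply_eq_base, ← hb']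
      · simpa [← hb', hagree m l] using (hd l).mul_mul_le s (φ l a) r' (φ l b)

/-- A pair of words with reduced first word can be replaced by one whose first word is any given
reduced word with the same product. -/
lemma exists_fst_eq (hd : ∀ l, IsTSIMetric (d l)) (hinj : ∀ l, Function.Injective (φ l))
    {Z : List (Σ l, G l)} (hZ : IsReduced φ Z) :
    ∀ (w : List (Σ l, G l × G l)) (a : A), IsReduced φ (w.map fstLetter) →
      wordProd φ (w.map fstLetter) = base φ a * wordProd φ Z →
      ∃ w' : List (Σ l, G l × G l), w'.map fstLetter = Z ∧ cost d w' = cost d w ∧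
        wordProd φ (w.map sndLetter) = base φ a * wordProd φ (w'.map sndLetter) := by
  induction Z with
  | nil =>
    intro w a hw h
    have hw' := hw.eq_nil hinj ⟨a, by simp [h]⟩
    obtain rfl : w = [] := by simpa using hw'
    exact ⟨[], rfl, rfl, by simpa using h⟩
  | cons y Z ih =>
    intro w a hw h
    rcases w with _ | ⟨x, w⟩
    · have := hZ.eq_nil hinj ⟨a⁻¹, by
        rw [map_inv, inv_eq_iff_mul_eq_one, ← h]
        simp⟩
      simp at this
    obtain ⟨a', ha'⟩ := head_eq_of_prod_eq hinj hw hZ a h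
    obtain ⟨l, s, t⟩ := x
    obtain ⟨m, r⟩ := y
    simp only [fstLetter, Sigma.mk.injEq] at ha'
    obtain ⟨rfl, ha'⟩ := ha'
    obtain rfl := eq_of_heq ha'
    obtain ⟨w', hw', hc, hsnd⟩ := ih hZ.tail w a'⁻¹ hw.tail (by
      simp only [List.map_cons, wordProd_cons, fstLetter, map_mul, of_apply_eq_base,
        mul_assoc, mul_right_inj] at h
      rw [map_inv, eq_inv_mul_iff_mul_eq]
      exact h)
    refine ⟨⟨l, r, (φ l a)⁻¹ * t * (φ l a')⁻¹⟩ :: w', by simp [hw', fstLetter], ?_, ?_⟩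
    · simp only [cost_cons, hc, (hd l).mul_inv_right, (hd l).inv_mul_right, mul_assoc]
    · simp [sndLetter, hsnd, of_apply_eq_base, mul_assoc]

lemma isReduced_snd_of_cost_lt (hd : ∀ l, IsTSIMetric (d l)) {K : ∀ l, Subgroup (G l)}
    (hK : ∀ l a, φ l a ∈ K l) {ε : ℝ} {v : List (Σ l, G l × G l)} {l : Λ}
    (hchain : (l :: v.map Sigma.fst).IsChain (· ≠ ·))
    (hv : ∀ x ∈ v, ∀ a, ε ≤ d x.1 x.2.1 (φ x.1 a)) {g t : G l} (hg : ∀ h ∈ K l, ε ≤ d l g h)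
    (hlt : cost d (⟨l, g, t⟩ :: v) < ε) : IsReduced φ ((⟨l, g, t⟩ :: v).map sndLetter) := by
  refine ⟨by simpa [Function.comp_def, sndLetter] using hchain, fun x hx => ?_⟩
  obtain ⟨y, hy, rfl⟩ := List.mem_map.1 hx
  rintro ⟨a, ha⟩
  obtain ⟨p, q, e⟩ := List.append_of_mem hy
  have h1 : d y.1 y.2.1 y.2.2 ≤ cost d (⟨l, g, t⟩ :: v) := by
    have hp := cost_nonneg hd p
    have hq := cost_nonneg hd q
    rw [e, cost_append, cost_cons]
    linarith
  have h2 : ε ≤ d y.1 y.2.1 (φ y.1 a) := by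
    rcases List.mem_cons.1 hy with rfl | hy
    · exact hg _ (hK l a)
    · exact hv y hy a
  rw [show φ y.1 a = y.2.2 from ha] at h2
  linarith

/-- A word consisting of letters in the subgroups `K`, a letter at distance at least `ε` from `K`,
and letters at distance at least `ε` from the amalgamated subgroup, alternating from the second
of these on, is at distance at least `ε` from every trivial word of the same shape. -/
lemma le_cost (hd : ∀ l, IsTSIMetric (d l)) (hinj : ∀ l, Function.Injective (φ l))
    (K : ∀ l, Subgroup (G l)) (hK : ∀ l a, φ l a ∈ K l) (ε : ℝ)
    {v : List (Σ l, G l × G l)} {l : Λ} (hchain : (l :: v.map Sigma.fst).IsChain (· ≠ ·))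
    (hv : ∀ x ∈ v, ∀ a, ε ≤ d x.1 x.2.1 (φ x.1 a)) (n : ℕ) :
    ∀ (u : List (Σ l, G l × G l)) (g t : G l), u.length ≤ n → (∀ x ∈ u, x.2.1 ∈ K x.1) →
      (∀ h ∈ K l, ε ≤ d l g h) → wordProd φ ((u ++ ⟨l, g, t⟩ :: v).map sndLetter) = 1 →
      ε ≤ cost d (u ++ ⟨l, g, t⟩ :: v) := by
  induction n with
  | zero =>
    intro u g t hu huK hg h1
    obtain rfl := List.length_eq_zero_iff.1 (Nat.le_zero.1 hu)
    by_contra! hlt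
    have := (isReduced_snd_of_cost_lt hd hK hchain hv hg hlt).eq_nil hinj (h1 ▸ one_mem _)
    simp at this
  | succ n ih =>
    intro u g t hu huK hg h1
    by_contra! hlt
    have hlt' : cost d (⟨l, g, t⟩ :: v) < ε := by
      have := cost_nonneg hd u
      rw [cost_append] at hlt
      linarith
    have hr := isReduced_snd_of_cost_lt hd hK hchain hv hg hlt'
    rcases List.eq_nil_or_concat' u with rfl | ⟨u, x, rfl⟩
    · have := hr.eq_nil hinj (h1 ▸ one_mem _)
      simp at this
    have hxK := huK x (by simp)
    by_cases hxl : x.1 = l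
    · obtain ⟨m, s, r⟩ := x
      obtain rfl : m = l := hxl
      refine hlt.not_ge ((ih u (s * g) (r * t) (by simpa using hu)
        (fun y hy => huK y (by simp [hy])) ?_ (by simpa [sndLetter, mul_assoc] using h1)).trans ?_)
      · intro h hh
        rw [← (hd m).inv_mul_right]
        exact hg _ (mul_mem (inv_mem hxK) hh)
      · have := (hd m).mul_mul_le s g r t
        simp
        linarith
    by_cases hxA : x.2.2 ∈ (φ x.1).range
    · obtain ⟨m, s, r⟩ := x
      obtain ⟨a, rfl⟩ : ∃ a, φ m a = r := hxA
      refine hlt.not_ge ((ih u (φ l a * g) (φ l a * t) (by simpa using hu)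
        (fun y hy => huK y (by simp [hy])) ?_
        (by simpa [sndLetter, mul_assoc, of_apply_eq_base] using h1)).trans ?_)
      · intro h hh
        rw [← (hd l).inv_mul_right]
        exact hg _ (mul_mem (inv_mem (hK l a)) hh)
      · have := (hd m).nonneg s (φ m a)
        simp [(hd l).2.2.2.1]
        linarith
    by_cases hred : IsReduced φ ((u ++ [x]).map sndLetter)
    · rw [List.map_append, List.map_singleton] at hred
      have := (IsReduced.append hxl hred hr).eq_nil hinj (by
        have : wordProd φ ((u ++ [x] ++ ⟨l, g, t⟩ :: v).map sndLetter) ∈ (base φ).range :=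
          h1 ▸ one_mem _
        simpa using this)
      simp at this
    have hlen : 2 ≤ (u ++ [x]).length := by
      rcases u with _ | ⟨y, u⟩
      · exact absurd ⟨by simp, by simpa [sndLetter] using hxA⟩ hred
      · simp
    obtain ⟨p, y, z, q, e, hyz⟩ := exists_contractible (φ := φ) sndLetter hlen hred
    rw [e] at h1 hlt hu huK
    obtain ⟨w, c, hc, hw, hwc, hwK, -⟩ := exists_contraction hd K hK hyz
    refine hlt.not_ge ((ih (p ++ w :: q) g t (by simp at hu ⊢; omega) ?_ hg
      (by simpa [sndLetter, mul_assoc, hw] using h1)).trans ?_)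
    · intro r hr
      simp only [List.mem_append, List.mem_cons] at hr
      rcases hr with hr | rfl | hr
      · exact huK r (by simp [hr])
      · exact hwK (huK y (by simp)) (huK z (by simp))
      · exact huK r (by simp [hr])
    · simp
      linarith

lemma exists_wordProd [Nonempty Λ] (x : PushoutI φ) : ∃ Z, wordProd φ Z = x := by
  induction x using PushoutI.induction_on with
  | of l g => exact ⟨[⟨l, g⟩], by simp⟩
  | base a =>
    obtain ⟨l⟩ := ‹Nonempty Λ›
    exact ⟨[⟨l, φ l a⟩], by simp [of_apply_eq_base]⟩
  | mul x y hx hy =>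
    obtain ⟨Z, rfl⟩ := hx
    obtain ⟨W, rfl⟩ := hy
    exact ⟨Z ++ W, by simp⟩

lemma le_cost_of_extends {dbar : PushoutI φ → PushoutI φ → ℝ} (hdbar : IsTSIMetric dbar)
    (hext : ∀ l g h, dbar (of l g) (of l h) = d l g h) (w : List (Σ l, G l × G l)) :
    dbar (wordProd φ (w.map fstLetter)) (wordProd φ (w.map sndLetter)) ≤ cost d w := by
  induction w with
  | nil => simp [hdbar.self_eq_zero]
  | cons x w ih =>
    simp only [List.map_cons, wordProd_cons, cost_cons]
    refine (hdbar.mul_mul_le _ _ _ _).trans (add_le_add ?_ ih)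
    exact (hext _ _ _).le

variable (d φ) in
/-- The costs of all lists of pairs connecting two elements. -/
def costs (x y : PushoutI φ) : Set ℝ :=
  {r | ∃ w : List (Σ l, G l × G l), wordProd φ (w.map fstLetter) = x ∧
    wordProd φ (w.map sndLetter) = y ∧ cost d w = r}

lemma zero_mem_costs [Nonempty Λ] (hd : ∀ l, IsTSIMetric (d l)) (x : PushoutI φ) :
    0 ∈ costs d φ x x := by
  obtain ⟨Z, rfl⟩ := exists_wordProd x
  refine ⟨Z.map fun x => ⟨x.1, x.2, x.2⟩, ?_, ?_, ?_⟩
  · simp [Function.comp_def, fstLetter]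
  · simp [Function.comp_def, sndLetter]
  · simp [cost, Function.comp_def, (hd _).self_eq_zero]

lemma mul_mem_costs {x y x' y' : PushoutI φ} {r r' : ℝ} (h : r ∈ costs d φ x y)
    (h' : r' ∈ costs d φ x' y') : r + r' ∈ costs d φ (x * x') (y * y') := by
  obtain ⟨w, rfl, rfl, rfl⟩ := h
  obtain ⟨w', rfl, rfl, rfl⟩ := h'
  exact ⟨w ++ w', by simp, by simp, by simp⟩

lemma mem_costs_symm (hd : ∀ l, IsTSIMetric (d l)) {x y : PushoutI φ} {r : ℝ}
    (h : r ∈ costs d φ x y) : r ∈ costs d φ y x := by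
  obtain ⟨w, rfl, rfl, rfl⟩ := h
  refine ⟨w.map fun x => ⟨x.1, x.2.2, x.2.1⟩, ?_, ?_, ?_⟩
  · rw [List.map_map]; rfl
  · rw [List.map_map]; rfl
  · simp only [cost, List.map_map, Function.comp_def]
    simp only [(hd _).2.1]

lemma mem_costs_of (l : Λ) (g h : G l) : d l g h ∈ costs d φ (of l g) (of l h) :=
  ⟨[⟨l, g, h⟩], by simp [fstLetter], by simp [sndLetter], by simp⟩

lemma mem_costs_trans [Nonempty Λ] (hd : ∀ l, IsTSIMetric (d l)) {x y z : PushoutI φ} {r s : ℝ}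
    (h : r ∈ costs d φ x y) (h' : s ∈ costs d φ y z) : r + s ∈ costs d φ x z := by
  simpa using mul_mem_costs (mul_mem_costs h (zero_mem_costs hd y⁻¹)) h'

lemma costs_nonempty [Nonempty Λ] (hd : ∀ l, IsTSIMetric (d l)) (x y : PushoutI φ) :
    (costs d φ x y).Nonempty := by
  have key : ∀ x : PushoutI φ, (costs d φ x 1).Nonempty := fun x => by
    obtain ⟨Z, rfl⟩ := exists_wordProd x
    induction Z with
    | nil => exact ⟨0, zero_mem_costs hd 1⟩
    | cons x Z ih =>
      obtain ⟨r, hr⟩ := ih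
      exact ⟨d x.1 x.2 1 + r, by simpa using mul_mem_costs (mem_costs_of x.1 x.2 1) hr⟩
  obtain ⟨r, hr⟩ := key x
  obtain ⟨s, hs⟩ := key y
  exact ⟨_, mem_costs_trans hd hr (mem_costs_symm hd hs)⟩

lemma bddBelow_costs (hd : ∀ l, IsTSIMetric (d l)) (x y : PushoutI φ) :
    BddBelow (costs d φ x y) := by
  refine ⟨0, ?_⟩
  rintro r ⟨w, -, -, rfl⟩
  exact cost_nonneg hd w

/-- The infimum of the costs is a two-sided invariant metric extending the amalgam metric as soon
as there is one. -/
lemma isTSIMetric_sInf_costs [Nonempty Λ] (hd : ∀ l, IsTSIMetric (d l))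
    {dbar : PushoutI φ → PushoutI φ → ℝ} (hdbar : IsTSIMetric dbar)
    (hext : ExtendsAmalgamMetric φ d dbar) :
    IsTSIMetric (fun x y => sInf (costs d φ x y)) ∧
      ExtendsAmalgamMetric φ d (fun x y => sInf (costs d φ x y)) := by
  have hle : ∀ x y, dbar x y ≤ sInf (costs d φ x y) := fun x y => by
    refine le_csInf (costs_nonempty hd x y) ?_
    rintro r ⟨w, rfl, rfl, rfl⟩
    exact le_cost_of_extends hdbar hext.1 w
  have hmem : ∀ {x y r}, r ∈ costs d φ x y → sInf (costs d φ x y) ≤ r :=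
    fun h => csInf_le (bddBelow_costs hd _ _) h
  have hmul : ∀ g x y, costs d φ x y ⊆ costs d φ (g * x) (g * y) := fun g x y r hr => by
    simpa using mul_mem_costs (zero_mem_costs hd g) hr
  have hmul' : ∀ g x y, costs d φ x y ⊆ costs d φ (x * g) (y * g) := fun g x y r hr => by
    simpa using mul_mem_costs hr (zero_mem_costs hd g)
  refine ⟨⟨fun x y => ⟨fun h => ?_, ?_⟩, fun x y => ?_, fun x y z => ?_, fun g x y => ?_,
    fun g x y => ?_⟩, fun l g h => ?_, fun l m hlm g h => ?_⟩
  · exact (hdbar.1 x y).1 (le_antisymm ((hle x y).trans h.le) (hdbar.nonneg x y))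
  · rintro rfl
    exact le_antisymm (hmem (zero_mem_costs hd x)) ((hdbar.nonneg x x).trans (hle x x))
  · exact congrArg sInf (Set.ext fun r => ⟨mem_costs_symm hd, mem_costs_symm hd⟩)
  · refine le_of_forall_pos_lt_add fun ε hε => ?_
    obtain ⟨r, hr, hr'⟩ := exists_lt_of_csInf_lt (costs_nonempty hd x y)
      (lt_add_of_pos_right (sInf (costs d φ x y)) (half_pos hε))
    obtain ⟨s, hs, hs'⟩ := exists_lt_of_csInf_lt (costs_nonempty hd y z)
      (lt_add_of_pos_right (sInf (costs d φ y z)) (half_pos hε))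
    have := hmem (mem_costs_trans hd hr hs)
    linarith
  · refine congrArg sInf (Set.Subset.antisymm ?_ (hmul g x y))
    simpa using hmul g⁻¹ (g * x) (g * y)
  · refine congrArg sInf (Set.Subset.antisymm ?_ (hmul' g x y))
    simpa using hmul' g⁻¹ (x * g) (y * g)
  · exact le_antisymm (hmem (mem_costs_of l g h)) ((hext.1 l g h).ge.trans (hle _ _))
  · refine le_antisymm (le_ciInf fun a => hmem (mem_costs_trans hd
      (mem_costs_of l g (φ l a)) ?_)) ((hext.2 l m hlm g h).ge.trans (hle _ _))
    have := mem_costs_of (φ := φ) (d := d) m (φ m a) h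
    rwa [of_apply_eq_base] at this ⊢

lemma exists_cost_lt [Nonempty Λ] (hd : ∀ l, IsTSIMetric (d l))
    {dbar : PushoutI φ → PushoutI φ → ℝ} (hdbar : IsTSIMetric dbar)
    (hext : ExtendsAmalgamMetric φ d dbar)
    (hmax : ∀ δ : PushoutI φ → PushoutI φ → ℝ, IsTSIMetric δ → ExtendsAmalgamMetric φ d δ →
      ∀ x y : PushoutI φ, δ x y ≤ dbar x y) {x y : PushoutI φ} {c : ℝ} (hc : dbar x y < c) :
    ∃ w : List (Σ l, G l × G l), wordProd φ (w.map fstLetter) = x ∧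
      wordProd φ (w.map sndLetter) = y ∧ cost d w < c := by
  obtain ⟨h1, h2⟩ := isTSIMetric_sInf_costs hd hdbar hext
  obtain ⟨r, ⟨w, hx, hy, rfl⟩, hr⟩ :=
    exists_lt_of_csInf_lt (costs_nonempty hd x y) ((hmax _ h1 h2 x y).trans_lt hc)
  exact ⟨w, hx, hy, hr⟩

/-- The distance from a reduced word to `1` is realized, up to an arbitrarily small error, by letterwise
changes of this word. -/
lemma exists_cost_lt_of_isReduced [Nonempty Λ] (hd : ∀ l, IsTSIMetric (d l))
    (hinj : ∀ l, Function.Injective (φ l))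
    (hagree : ∀ (l₁ l₂ : Λ) (a a' : A), d l₁ (φ l₁ a) (φ l₁ a') = d l₂ (φ l₂ a) (φ l₂ a'))
    {dbar : PushoutI φ → PushoutI φ → ℝ} (hdbar : IsTSIMetric dbar)
    (hext : ExtendsAmalgamMetric φ d dbar)
    (hmax : ∀ δ : PushoutI φ → PushoutI φ → ℝ, IsTSIMetric δ → ExtendsAmalgamMetric φ d δ →
      ∀ x y : PushoutI φ, δ x y ≤ dbar x y) {Z : List (Σ l, G l)} (hZ : IsReduced φ Z)
    (hZ0 : Z ≠ []) {c : ℝ} (hc : dbar (wordProd φ Z) 1 < c) :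
    ∃ w : List (Σ l, G l × G l), w.map fstLetter = Z ∧
      wordProd φ (w.map sndLetter) = 1 ∧ cost d w < c := by
  obtain ⟨w, hw, hw1, hwc⟩ := exists_cost_lt hd hdbar hext hmax hc
  obtain ⟨w₁, hr, h₁, h₁1, h₁c⟩ := exists_isReduced_fst hd hinj hagree _ w le_rfl
    (fun h => hZ0 (hZ.eq_nil hinj (hw ▸ h))) hw1
  obtain ⟨w₂, h₂, h₂c, h₂1⟩ := exists_fst_eq hd hinj hZ w₁ 1 hr (by simp [h₁, hw])
  exact ⟨w₂, h₂, by simpa [h₁1] using h₂1.symm, by linarith⟩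

lemma exists_split_of_isReduced (K : ∀ l, Subgroup (G l)) {Z : List (Σ l, G l)}
    (hZ : IsReduced φ Z) (hZK : ¬ ∀ x ∈ Z, x.2 ∈ K x.1) :
    ∃ u g v, Z = u ++ g :: v ∧ (∀ x ∈ u, x.2 ∈ K x.1) ∧ g.2 ∉ K g.1 ∧
      IsReduced φ (g :: v) := by
  induction Z with
  | nil => simp at hZK
  | cons x Z ih =>
    by_cases hx : x.2 ∈ K x.1
    · obtain ⟨u, g, v, rfl, hu, hg, hr⟩ := ih hZ.tail fun h => hZK (by simpa [hx] using h)
      exact ⟨x :: u, g, v, rfl, by simpa [hx] using hu, hg, hr⟩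
    · exact ⟨[], x, Z, rfl, by simp, hx, hZ⟩

/-- A word whose product is not the product of a word in the subgroups `K l` can be rewritten
so that a `K`-word is followed by a reduced word with first letter outside `K`. -/
lemma exists_split (K : ∀ l, Subgroup (G l)) (hK : ∀ l a, φ l a ∈ K l) (Z : List (Σ l, G l))
    (hZ : ∀ W : List (Σ l, G l), (∀ x ∈ W, x.2 ∈ K x.1) → wordProd φ W ≠ wordProd φ Z) :
    ∃ u g v, wordProd φ (u ++ g :: v) = wordProd φ Z ∧ (∀ x ∈ u, x.2 ∈ K x.1) ∧
      g.2 ∉ K g.1 ∧ IsReduced φ (g :: v) := by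
  obtain ⟨W, hW, -, -, h1⟩ :=
    exists_reduced (φ := φ) (fun _ => ⊤) (fun _ _ => trivial) _ Z le_rfl (fun _ _ => trivial)
  have hWK : ¬ ∀ x ∈ W, x.2 ∈ K x.1 := fun h => hZ W h hW
  have hr : IsReduced φ W := by
    refine h1.elim (fun h => ?_) id
    rcases W with _ | ⟨x, _ | ⟨y, W⟩⟩
    · simp at hWK
    · exact ⟨by simp, by simpa using fun a ha => hWK (by simpa [← ha] using hK x.1 a)⟩
    · simp at h
  obtain ⟨u, g, v, rfl, h⟩ := exists_split_of_isReduced K hr hWK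
  exact ⟨u, g, v, hW, h⟩

/-- A word in the subgroups `K l` in front of a reduced word whose first letter has distance at
least `ε` from `K l` can be rewritten to make the whole word reduced. -/
lemma exists_isReduced_append (hd : ∀ l, IsTSIMetric (d l)) (K : ∀ l, Subgroup (G l))
    (hK : ∀ l a, φ l a ∈ K l) {ε : ℝ} (hε : 0 < ε) {l : Λ} {v : List (Σ l, G l)} (n : ℕ) :
    ∀ (u : List (Σ l, G l)) (g : G l), u.length ≤ n → (∀ x ∈ u, x.2 ∈ K x.1) →
      (∀ h ∈ K l, ε ≤ d l g h) → IsReduced φ (⟨l, g⟩ :: v) →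
      ∃ u' g', wordProd φ (u' ++ ⟨l, g'⟩ :: v) = wordProd φ (u ++ ⟨l, g⟩ :: v) ∧
        (∀ x ∈ u', x.2 ∈ K x.1) ∧ (∀ h ∈ K l, ε ≤ d l g' h) ∧
        IsReduced φ (u' ++ ⟨l, g'⟩ :: v) := by
  induction n with
  | zero =>
    intro u g hu huK hg hr
    obtain rfl := List.length_eq_zero_iff.1 (Nat.le_zero.1 hu)
    exact ⟨[], g, rfl, huK, hg, hr⟩
  | succ n ih =>
    intro u g hu huK hg hr
    obtain ⟨W, hW, hWK, hWl, h1⟩ := exists_reduced K hK _ u le_rfl huK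
    rcases List.eq_nil_or_concat' W with rfl | ⟨p, z, rfl⟩
    · exact ⟨[], g, by simp [← hW], by simp, hg, hr⟩
    have hpK : ∀ x ∈ p, x.2 ∈ K x.1 := fun x hx => hWK x (by simp [hx])
    have hzK : z.2 ∈ K z.1 := hWK z (by simp)
    have hp : p.length ≤ n := by simp at hWl; omega
    have absorb : ∀ k ∈ K l, (of l k : PushoutI φ) = of z.1 z.2 →
        ∃ u' g', wordProd φ (u' ++ ⟨l, g'⟩ :: v) = wordProd φ (u ++ ⟨l, g⟩ :: v) ∧
          (∀ x ∈ u', x.2 ∈ K x.1) ∧ (∀ h ∈ K l, ε ≤ d l g' h) ∧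
          IsReduced φ (u' ++ ⟨l, g'⟩ :: v) := by
      intro k hk hkz
      have hkg : ∀ h ∈ K l, ε ≤ d l (k * g) h := fun h hh => by
        rw [← (hd l).inv_mul_right]
        exact hg _ (mul_mem (inv_mem hk) hh)
      have hkr : k * g ∉ (φ l).range := by
        rintro ⟨a, ha⟩
        have := hkg _ (ha ▸ hK l a)
        rw [(hd l).self_eq_zero] at this
        linarith
      obtain ⟨u', g', h, h'⟩ := ih p (k * g) hp hpK hkg
        (isReduced_append_cons (u := []) (x := ⟨l, k * g⟩) (y := ⟨l, g⟩) rfl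
          ⟨by simp, by simpa using hkr⟩ hr _ hkr)
      exact ⟨u', g', by simp [h, ← hW, hkz, mul_assoc], h'⟩
    by_cases hzl : z.1 = l
    · obtain ⟨m, z⟩ := z
      obtain rfl : m = l := hzl
      exact absorb z hzK rfl
    by_cases hza : z.2 ∈ (φ z.1).range
    · obtain ⟨a, ha⟩ := hza
      exact absorb (φ l a) (hK l a) (by rw [← ha, of_apply_eq_base, of_apply_eq_base])
    have hWr : IsReduced φ (p ++ [z]) := by
      refine h1.elim (fun h => ?_) id
      obtain rfl : p = [] := by simpa using h
      exact ⟨by simp, by simpa using hza⟩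
    refine ⟨p ++ [z], g, by simp [← hW, mul_assoc], hWK, hg, ?_⟩
    simpa using hWr.append hzl hr

lemma exists_pos_le {X : Type*} (l : List X) (p : X → ℝ → Prop)
    (hp : ∀ x r s, s ≤ r → p x r → p x s) (h : ∀ x ∈ l, ∃ ε > 0, p x ε) :
    ∃ ε > 0, ∀ x ∈ l, p x ε := by
  induction l with
  | nil => exact ⟨1, one_pos, by simp⟩
  | cons x l ih =>
    obtain ⟨ε, hε, h1⟩ := h x (by simp)
    obtain ⟨ε', hε', h2⟩ := ih fun y hy => h y (by simp [hy])
    refine ⟨min ε ε', lt_min hε hε', fun y hy => ?_⟩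
    rcases List.mem_cons.1 hy with rfl | hy
    · exact hp _ _ _ (min_le_left _ _) h1
    · exact hp _ _ _ (min_le_right _ _) (h2 y hy)

lemma exists_pos_le_of_isDClosed {X : Type*} [Group X] {δ : X → X → ℝ} {S : Set X}
    (hS : IsDClosed δ S) {x : X} (hx : x ∉ S) : ∃ ε > 0, ∀ s ∈ S, ε ≤ δ x s := by
  by_contra! h
  exact hx (hS x h)

/-- An element which is not the product of a word in the closed subgroups `K l` has positive
distance from all such products. -/
lemma exists_pos_le_dist [Nonempty Λ] (hd : ∀ l, IsTSIMetric (d l))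
    (hinj : ∀ l, Function.Injective (φ l))
    (hclosed : ∀ l, IsDClosed (d l) (Set.range (φ l)))
    (hagree : ∀ (l₁ l₂ : Λ) (a a' : A), d l₁ (φ l₁ a) (φ l₁ a') = d l₂ (φ l₂ a) (φ l₂ a'))
    {dbar : PushoutI φ → PushoutI φ → ℝ} (hdbar : IsTSIMetric dbar)
    (hext : ExtendsAmalgamMetric φ d dbar)
    (hmax : ∀ δ : PushoutI φ → PushoutI φ → ℝ, IsTSIMetric δ → ExtendsAmalgamMetric φ d δ →
      ∀ x y : PushoutI φ, δ x y ≤ dbar x y)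
    (K : ∀ l, Subgroup (G l)) (hK : ∀ l a, φ l a ∈ K l)
    (hKc : ∀ l, IsDClosed (d l) (K l : Set (G l))) (x : PushoutI φ)
    (hx : ∀ W : List (Σ l, G l), (∀ t ∈ W, t.2 ∈ K t.1) → wordProd φ W ≠ x) :
    ∃ ε > 0, ∀ W : List (Σ l, G l), (∀ t ∈ W, t.2 ∈ K t.1) → ε ≤ dbar x (wordProd φ W) := by
  obtain ⟨Z, rfl⟩ := exists_wordProd x
  obtain ⟨u, ⟨l, g⟩, v, hZ, hu, hg, hr⟩ := exists_split K hK Z hx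
  obtain ⟨ε₁, hε₁, h₁⟩ := exists_pos_le_of_isDClosed (hKc l) hg
  obtain ⟨ε₂, hε₂, h₂⟩ := exists_pos_le v (fun t ε => ∀ a, ε ≤ d t.1 t.2 (φ t.1 a))
    (fun t r s hsr h a => hsr.trans (h a)) fun t ht => by
      obtain ⟨ε, hε, h⟩ := exists_pos_le_of_isDClosed (hclosed t.1) (x := t.2)
        (hr.2 t (List.mem_cons_of_mem _ ht))
      exact ⟨ε, hε, fun a => h _ ⟨a, rfl⟩⟩
  refine ⟨min ε₁ ε₂, lt_min hε₁ hε₂, fun W hW => ?_⟩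
  by_contra! hlt
  obtain ⟨u', g', hp, hu', hg', hr'⟩ := exists_isReduced_append hd K hK (lt_min hε₁ hε₂) _
    (wordInv W ++ u) g le_rfl (by
      intro t ht
      rcases List.mem_append.1 ht with ht | ht
      · simp only [wordInv, List.mem_reverse, List.mem_map] at ht
        obtain ⟨y, hy, rfl⟩ := ht
        exact inv_mem (hW y hy)
      · exact hu t ht) (fun h hh => (min_le_left _ _).trans (h₁ h hh)) hr
  obtain ⟨w, hw, hw1, hwc⟩ := exists_cost_lt_of_isReduced hd hinj hagree hdbar hext hmax hr'
    (by simp) (c := min ε₁ ε₂) (by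
      rwa [hp, List.append_assoc, wordProd_append, hZ, wordProd_wordInv,
        ← hdbar.2.2.2.1 (wordProd φ W), mul_inv_cancel_left, mul_one])
  rw [List.map_eq_append_iff] at hw
  obtain ⟨p, q, rfl, hp', hq⟩ := hw
  rw [List.map_eq_cons_iff] at hq
  obtain ⟨⟨m, s, t⟩, q, rfl, hm, rfl⟩ := hq
  simp only [fstLetter, Sigma.mk.injEq] at hm
  obtain ⟨rfl, hm⟩ := hm
  obtain rfl := eq_of_heq hm
  refine absurd (le_cost hd hinj K hK (min ε₁ ε₂) (l := m) (v := q) ?_ ?_ _ p s t le_rfl ?_ hg' hw1)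
    hwc.not_ge
  · simpa [Function.comp_def, fstLetter] using hr.1
  · exact fun y hy a => (min_le_right _ _).trans (h₂ _ (List.mem_map_of_mem hy) a)
  · exact fun y hy => hu' _ (hp' ▸ List.mem_map_of_mem hy)

end Pairs

section Subamalgam

variable {Λ : Type*} {G : Λ → Type*} [∀ l, Group (G l)] {A : Type*} [Group A]
  {φ : ∀ l, A →* G l} {H : ∀ l, Subgroup (G l)} {φ' : ∀ l, A →* ↥(H l)}
  {Φ : PushoutI φ' →* PushoutI φ}

lemma exists_eq_wordProd
    (hΦ : ∀ (l : Λ) (h : ↥(H l)), Φ (of (φ := φ') l h) = of (φ := φ) l (h : G l))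
    (Z : List (Σ l, G l)) (hZ : ∀ x ∈ Z, x.2 ∈ H x.1) : ∃ y, Φ y = wordProd φ Z := by
  induction Z with
  | nil => exact ⟨1, by simp⟩
  | cons x Z ih =>
    obtain ⟨y, hy⟩ := ih fun t ht => hZ t (by simp [ht])
    exact ⟨of x.1 ⟨x.2, hZ x (by simp)⟩ * y, by simp [hy, hΦ]⟩

lemma exists_wordProd_eq_apply [Nonempty Λ]
    (hΦ : ∀ (l : Λ) (h : ↥(H l)), Φ (of (φ := φ') l h) = of (φ := φ) l (h : G l))
    (y : PushoutI φ') : ∃ Z : List (Σ l, G l), (∀ x ∈ Z, x.2 ∈ H x.1) ∧ wordProd φ Z = Φ y := by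
  obtain ⟨Z, rfl⟩ := exists_wordProd y
  refine ⟨Z.map fun x => ⟨x.1, x.2⟩, fun x hx => ?_, ?_⟩
  · obtain ⟨t, -, rfl⟩ := List.mem_map.1 hx
    exact t.2.2
  induction Z with
  | nil => simp
  | cons x Z ih => simp [ih, hΦ]

lemma exists_le_cost {d : ∀ l, G l → G l → ℝ}
    (hΦ : ∀ (l : Λ) (h : ↥(H l)), Φ (of (φ := φ') l h) = of (φ := φ) l (h : G l))
    {δ : PushoutI φ' → PushoutI φ' → ℝ} (hδ : IsTSIMetric δ)
    (hext : ∀ (l : Λ) (g h : ↥(H l)), δ (of l g) (of l h) = d l g h)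
    (w : List (Σ l, G l × G l)) (hw : ∀ x ∈ w, x.2.1 ∈ H x.1 ∧ x.2.2 ∈ H x.1) :
    ∃ x y, Φ x = wordProd φ (w.map fstLetter) ∧ Φ y = wordProd φ (w.map sndLetter) ∧
      δ x y ≤ cost d w := by
  induction w with
  | nil => exact ⟨1, 1, by simp, by simp, (hδ.self_eq_zero 1).le⟩
  | cons z w ih =>
    obtain ⟨x, y, hx, hy, h⟩ := ih fun t ht => hw t (by simp [ht])
    obtain ⟨h1, h2⟩ := hw z (by simp)
    refine ⟨of z.1 ⟨z.2.1, h1⟩ * x, of z.1 ⟨z.2.2, h2⟩ * y, by simp [hΦ, hx, fstLetter],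
      by simp [hΦ, hy, sndLetter], ?_⟩
    rw [cost_cons]
    exact (hδ.mul_mul_le _ _ _ _).trans (add_le_add (hext _ _ _).le h)

lemma isTSIMetric_comap {P Q : Type*} [Group P] [Group Q] {δ : Q → Q → ℝ} (hδ : IsTSIMetric δ)
    (f : P →* Q) (hf : Function.Injective f) : IsTSIMetric fun x y => δ (f x) (f y) := by
  obtain ⟨h1, h2, h3, h4, h5⟩ := hδ
  exact ⟨fun x y => (h1 _ _).trans hf.eq_iff, fun x y => h2 _ _, fun x y z => h3 _ _ _,
    fun g x y => by simp [h4], fun g x y => by simp [h5]⟩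

lemma extendsAmalgamMetric_comap {d : ∀ l, G l → G l → ℝ}
    {dbar : PushoutI φ → PushoutI φ → ℝ} (hext : ExtendsAmalgamMetric φ d dbar)
    (hφ' : ∀ (l : Λ) (a : A), ((φ' l a : G l)) = φ l a)
    (hΦ : ∀ (l : Λ) (h : ↥(H l)), Φ (of (φ := φ') l h) = of (φ := φ) l (h : G l)) :
    ExtendsAmalgamMetric φ' (fun l (x y : ↥(H l)) => d l ↑x ↑y)
      (fun x y : PushoutI φ' => dbar (Φ x) (Φ y)) := by
  refine ⟨fun l g h => ?_, fun l m hlm g h => ?_⟩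
  · simp only [hΦ]
    exact hext.1 _ _ _
  · simp only [hΦ, hφ']
    exact hext.2 _ _ hlm _ _

/-- Every two-sided invariant metric extending the amalgam metric of the subgroups is dominated
by the restriction of the Graev metric. -/
lemma le_comap [Nonempty Λ] {d : ∀ l, G l → G l → ℝ} (hd : ∀ l, IsTSIMetric (d l))
    (hinj : ∀ l, Function.Injective (φ l))
    (hagree : ∀ (l₁ l₂ : Λ) (a a' : A), d l₁ (φ l₁ a) (φ l₁ a') = d l₂ (φ l₂ a) (φ l₂ a'))
    {dbar : PushoutI φ → PushoutI φ → ℝ} (hdbar : IsTSIMetric dbar)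
    (hext : ExtendsAmalgamMetric φ d dbar)
    (hmax : ∀ δ : PushoutI φ → PushoutI φ → ℝ, IsTSIMetric δ → ExtendsAmalgamMetric φ d δ →
      ∀ x y : PushoutI φ, δ x y ≤ dbar x y) (hAH : ∀ (l : Λ) (a : A), φ l a ∈ H l)
    (hΦ : ∀ (l : Λ) (h : ↥(H l)), Φ (of (φ := φ') l h) = of (φ := φ) l (h : G l))
    (hΦinj : Function.Injective Φ) {δ : PushoutI φ' → PushoutI φ' → ℝ} (hδ : IsTSIMetric δ)
    (hδext : ∀ (l : Λ) (g h : ↥(H l)), δ (of l g) (of l h) = d l g h) (x y : PushoutI φ') :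
    δ x y ≤ dbar (Φ x) (Φ y) := by
  have key : ∀ z, δ z 1 ≤ dbar (Φ z) 1 := by
    intro z
    obtain ⟨Z, hZH, hZ⟩ := exists_wordProd_eq_apply hΦ z
    obtain ⟨W, hW, hWH, -, h1⟩ := exists_reduced H hAH _ Z le_rfl hZH
    have hWz : wordProd φ W = Φ z := hW.trans hZ
    by_cases hl : W.length ≤ 1
    · rcases W with _ | ⟨g, _ | ⟨g', W⟩⟩
      · obtain rfl : z = 1 := hΦinj (by simpa using hWz.symm)
        simpa [hδ.self_eq_zero] using hdbar.nonneg _ _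
      · obtain rfl : z = of g.1 ⟨g.2, hWH g (by simp)⟩ := hΦinj (by simp [hΦ, ← hWz])
        have e1 := hδext g.1 ⟨g.2, hWH g (by simp)⟩ 1
        have e2 := hext.1 g.1 g.2 1
        rw [map_one] at e1 e2
        rw [e1, hΦ, e2]
        rfl
      · simp at hl
    · refine le_of_forall_gt fun c hc => ?_
      obtain ⟨w, hw, hw1, hwc⟩ := exists_cost_lt_of_isReduced hd hinj hagree hdbar hext hmax
        (h1.resolve_left hl) (by rintro rfl; simp at hl) (hWz ▸ hc)
      obtain ⟨w', hw', hw'H, hw'1, hw'c⟩ := exists_mem_subgroup hd hinj H hAH _ w le_rfl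
        (fun t ht => hWH _ (hw ▸ List.mem_map_of_mem ht)) hw1
      obtain ⟨x, y, hx, hy, hxy⟩ := exists_le_cost hΦ hδ hδext w' hw'H
      obtain rfl : x = z := hΦinj (by rw [hx, hw', hw, hWz])
      obtain rfl : y = 1 := hΦinj (by rw [hy, hw'1, map_one])
      linarith
  have := key (x * y⁻¹)
  rwa [← hδ.2.2.2.2 y, ← hdbar.2.2.2.2 (Φ y), map_mul, map_inv, inv_mul_cancel_right,
    inv_mul_cancel_right, one_mul, one_mul] at this

end Subamalgam

end Amalgam

/-- Graev metrics on amalgams behave well with respect to subgroups: if `H λ ≤ G λ` are subgroups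
containing the amalgamated subgroup, then the Graev metric on `∐_A H λ` is the pullback of the
Graev metric on `∐_A G λ` along the canonical homomorphism `Φ`, and if all the `H λ` are closed
then the image of `Φ` is closed. -/
theorem graev_metric_subamalgam {Λ : Type*} [Nonempty Λ] {G : Λ → Type*} [∀ l, Group (G l)]
    (d : ∀ l, G l → G l → ℝ) (hd : ∀ l, IsTSIMetric (d l))
    {A : Type*} [Group A] (φ : ∀ l, A →* G l)
    (hinj : ∀ l, Function.Injective (φ l))
    (hclosed : ∀ l, IsDClosed (d l) (Set.range (φ l)))
    (hagree : ∀ (l₁ l₂ : Λ) (a a' : A), d l₁ (φ l₁ a) (φ l₁ a') = d l₂ (φ l₂ a) (φ l₂ a'))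
    (dbar : Monoid.PushoutI φ → Monoid.PushoutI φ → ℝ)
    (hdbar : IsTSIMetric dbar) (hext : ExtendsAmalgamMetric φ d dbar)
    (hmax : ∀ δ : Monoid.PushoutI φ → Monoid.PushoutI φ → ℝ,
      IsTSIMetric δ → ExtendsAmalgamMetric φ d δ →
      ∀ x y : Monoid.PushoutI φ, δ x y ≤ dbar x y)
    (H : ∀ l, Subgroup (G l)) (hAH : ∀ (l : Λ) (a : A), φ l a ∈ H l)
    (φ' : ∀ l, A →* ↥(H l)) (hφ' : ∀ (l : Λ) (a : A), ((φ' l a : G l)) = φ l a)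
    (Φ : Monoid.PushoutI φ' →* Monoid.PushoutI φ)
    (hΦ : ∀ (l : Λ) (h : ↥(H l)),
      Φ (Monoid.PushoutI.of (φ := φ') l h) = Monoid.PushoutI.of (φ := φ) l (h : G l))
    (hΦinj : Function.Injective Φ) :
    (IsTSIMetric (fun x y : Monoid.PushoutI φ' => dbar (Φ x) (Φ y)) ∧
      ExtendsAmalgamMetric φ' (fun l (x y : ↥(H l)) => d l ↑x ↑y)
        (fun x y : Monoid.PushoutI φ' => dbar (Φ x) (Φ y)) ∧
      (∀ δ : Monoid.PushoutI φ' → Monoid.PushoutI φ' → ℝ,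
        IsTSIMetric δ → ExtendsAmalgamMetric φ' (fun l (x y : ↥(H l)) => d l ↑x ↑y) δ →
        ∀ x y : Monoid.PushoutI φ', δ x y ≤ dbar (Φ x) (Φ y))) ∧
    ((∀ l, IsDClosed (d l) (H l : Set (G l))) → IsDClosed dbar (Set.range Φ)) := by
  refine ⟨⟨Amalgam.isTSIMetric_comap hdbar Φ hΦinj,
    Amalgam.extendsAmalgamMetric_comap hext hφ' hΦ, fun δ hδ hδext =>
      Amalgam.le_comap hd hinj hagree hdbar hext hmax hAH hΦ hΦinj hδ hδext.1⟩,
    fun hHc x hx => ?_⟩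
  by_contra hxr
  obtain ⟨ε, hε, h⟩ := Amalgam.exists_pos_le_dist hd hinj hclosed hagree hdbar hext hmax H hAH hHc x
    fun W hW hWx => by
      obtain ⟨y, hy⟩ := Amalgam.exists_eq_wordProd hΦ W hW
      exact hxr ⟨y, hy.trans hWx⟩
  obtain ⟨_, ⟨y, rfl⟩, hy⟩ := hx ε hε
  obtain ⟨W, hW, hWy⟩ := Amalgam.exists_wordProd_eq_apply hΦ y
  exact (h W hW).not_gt (hWy ▸ hy)
end

section
/- Assume the amalgam setting: groups (G_λ, d_λ) with two-sided invariant metrics, a group A with injective homomorphisms φ_λ : A → G_λ having closed images and with d_{λ₁}(φ_{λ₁}(a), φ_{λ₁}(a')) = d_{λ₂}(φ_{λ₂}(a), φ_{λ₂}(a')) for all a, a' ∈ A, λ₁, λ₂. Let d̄ be the Graev metric on ∐_A G_λ. Let n ≥ 1, let λ₁, …, λ_n ∈ Λ with λ_i ≠ λ_{i+1} for all i, and let g_i ∈ G_{λ_i} with g_i ∉ φ_{λ_i}(A) for all i. Then d̄( of_{λ₁}(g₁) · of_{λ₂}(g₂) ⋯ of_{λ_n}(g_n), 1 ) ≥ min_{1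 ≤ i ≤ n} inf_{a ∈ A} d_{λ_i}(g_i, φ_{λ_i}(a)). -/
section GraevNorm

open Monoid Monoid.PushoutI

theorem IsTSIMetric.nonneg_s4 {G : Type*} [Group G] {d : G → G → ℝ} (hd : IsTSIMetric d) (x y : G) :
    0 ≤ d x y := by
  obtain ⟨h0, hs, ht, -, -⟩ := hd
  linarith [ht x y x, hs x y, (h0 x x).2 rfl]

theorem IsTSIMetric.mul_le {G : Type*} [Group G] {d : G → G → ℝ} (hd : IsTSIMetric d)
    (x y x' y' : G) : d (x * y) (x' * y') ≤ d x x' + d y y' := by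
  obtain ⟨-, -, ht, hl, hr⟩ := hd
  linarith [ht (x * y) (x' * y) (x' * y'), hl x' y y', hr y x x']

theorem IsTSIMetric.inv_inv {G : Type*} [Group G] {d : G → G → ℝ} (hd : IsTSIMetric d)
    (x y : G) : d x⁻¹ y⁻¹ = d x y := by
  obtain ⟨-, hs, -, hl, hr⟩ := hd
  rw [hs x y, ← hl x, ← hr y]
  simp

variable {Λ : Type*} {G : Λ → Type*}

/-- The total distance between the components of a word of pairs. -/
def cost (d : ∀ l, G l → G l → ℝ) (L : List (Σ l, G l × G l)) : ℝ :=
  (L.map fun t => d t.1 t.2.1 t.2.2).sum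

variable {d : ∀ l, G l → G l → ℝ}

@[simp]
theorem cost_cons (t : Σ l, G l × G l) (L : List (Σ l, G l × G l)) :
    cost d (t :: L) = d t.1 t.2.1 t.2.2 + cost d L := by
  simp [cost]

@[simp]
theorem cost_append (L M : List (Σ l, G l × G l)) : cost d (L ++ M) = cost d L + cost d M := by
  simp [cost]

variable [∀ l, Group (G l)] {A : Type*} [Group A]

/-- The inverse of a word in the letters of a family of groups. -/
def invWord (L : List (Σ l, G l)) : List (Σ l, G l) :=
  (L.map fun t => ⟨t.1, t.2⁻¹⟩).reverse

@[simp]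
theorem length_invWord (L : List (Σ l, G l)) : (invWord L).length = L.length := by
  simp [invWord]

theorem invWord_cons (t : Σ l, G l) (L : List (Σ l, G l)) :
    invWord (t :: L) = invWord L ++ [⟨t.1, t.2⁻¹⟩] := by
  simp [invWord]

/-- The word of first components of a word of pairs. -/
def fstWord (L : List (Σ l, G l × G l)) : List (Σ l, G l) := L.map fun t => ⟨t.1, t.2.1⟩

/-- The word of second components of a word of pairs. -/
def sndWord (L : List (Σ l, G l × G l)) : List (Σ l, G l) := L.map fun t => ⟨t.1, t.2.2⟩

theorem fstWord_invWord (L : List (Σ l, G l × G l)) :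
    fstWord (invWord L) = invWord (fstWord L) := by
  simp [fstWord, invWord, Function.comp_def]

theorem sndWord_invWord (L : List (Σ l, G l × G l)) :
    sndWord (invWord L) = invWord (sndWord L) := by
  simp [sndWord, invWord, Function.comp_def]

theorem cost_invWord (hd : ∀ l, IsTSIMetric (d l)) (L : List (Σ l, G l × G l)) :
    cost d (invWord L) = cost d L := by
  simp [cost, invWord, List.sum_reverse, Function.comp_def, (hd _).inv_inv]

theorem cost_nonneg (hd : ∀ l, IsTSIMetric (d l)) (L : List (Σ l, G l × G l)) : 0 ≤ cost d L :=
  List.sum_nonneg (by simp only [List.mem_map]; rintro _ ⟨t, -, rfl⟩; exact (hd _).nonneg_s4 _ _)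

theorem le_cost_of_mem (hd : ∀ l, IsTSIMetric (d l)) {L : List (Σ l, G l × G l)}
    {t : Σ l, G l × G l} (ht : t ∈ L) : d t.1 t.2.1 t.2.2 ≤ cost d L := by
  obtain ⟨P, Q, rfl⟩ := List.append_of_mem ht
  simp only [cost_append, cost_cons]
  linarith [cost_nonneg hd P, cost_nonneg hd Q]

variable (φ : ∀ l, A →* G l)

/-- The product of a word in the amalgamated product. -/
def evalWord (L : List (Σ l, G l)) : PushoutI φ := (L.map fun t => of t.1 t.2).prod

@[simp]
theorem evalWord_nil : evalWord φ [] = 1 := rfl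

@[simp]
theorem evalWord_cons (t : Σ l, G l) (L : List (Σ l, G l)) :
    evalWord φ (t :: L) = of t.1 t.2 * evalWord φ L := by
  simp [evalWord]

@[simp]
theorem evalWord_append (L M : List (Σ l, G l)) :
    evalWord φ (L ++ M) = evalWord φ L * evalWord φ M := by
  simp [evalWord]

@[simp]
theorem evalWord_invWord (L : List (Σ l, G l)) :
    evalWord φ (invWord L) = (evalWord φ L)⁻¹ := by
  induction L with
  | nil => simp [invWord]
  | cons t L ih => simp [invWord_cons, ih]

theorem exists_evalWord_eq [Nonempty Λ] (x : PushoutI φ) : ∃ L, evalWord φ L = x := by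
  induction x using PushoutI.induction_on with
  | of i g => exact ⟨[⟨i, g⟩], by simp⟩
  | base h =>
    obtain ⟨l⟩ := ‹Nonempty Λ›
    exact ⟨[⟨l, φ l h⟩], by simp [of_apply_eq_base]⟩
  | mul x y hx hy =>
    obtain ⟨L, rfl⟩ := hx
    obtain ⟨M, rfl⟩ := hy
    exact ⟨L ++ M, by simp⟩

/-- A word is reduced if consecutive letters lie in distinct factors and no letter lies in the
amalgamated subgroup. -/
def IsReducedWord (L : List (Σ l, G l)) : Prop :=
  L.IsChain (fun s t => s.1 ≠ t.1) ∧ ∀ t ∈ L, t.2 ∉ Set.range (φ t.1)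

variable {φ}

theorem IsReducedWord.tail {t : Σ l, G l} {L : List (Σ l, G l)}
    (h : IsReducedWord φ (t :: L)) : IsReducedWord φ L :=
  ⟨h.1.tail, fun s hs => h.2 s (List.mem_cons_of_mem _ hs)⟩

theorem IsReducedWord.head_ne {t : Σ l, G l} {L : List (Σ l, G l)}
    (h : IsReducedWord φ (t :: L)) : ∀ s ∈ L.head?, s.1 ≠ t.1 :=
  fun s hs => ((List.isChain_cons.1 h.1).1 s hs).symm

theorem isReducedWord_cons {t : Σ l, G l} {L : List (Σ l, G l)} (h : IsReducedWord φ L)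
    (ht : t.2 ∉ Set.range (φ t.1)) (hne : ∀ s ∈ L.head?, s.1 ≠ t.1) :
    IsReducedWord φ (t :: L) :=
  ⟨List.isChain_cons.2 ⟨fun s hs => (hne s hs).symm, h.1⟩, by
    exact List.forall_mem_cons.2 ⟨ht, h.2⟩⟩

theorem IsReducedWord.invWord_append_cons {L M : List (Σ l, G l)} {t : Σ l, G l}
    (hL : IsReducedWord φ L) (hM : IsReducedWord φ M) (ht : t.2 ∉ Set.range (φ t.1))
    (hLt : ∀ s ∈ L.head?, s.1 ≠ t.1) (hMt : ∀ s ∈ M.head?, s.1 ≠ t.1) :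
    IsReducedWord φ (invWord L ++ t :: M) := by
  refine ⟨List.isChain_append.2 ⟨?_, (isReducedWord_cons hM ht hMt).1, ?_⟩, ?_⟩
  · rw [invWord, List.isChain_reverse, List.isChain_map]
    exact hL.1.imp fun _ _ h => h.symm
  · simp only [invWord, List.getLast?_reverse, List.head?_map, List.head?_cons]
    intro x hx y hy
    obtain ⟨s, hs, rfl⟩ := Option.mem_map.1 hx
    obtain rfl := Option.mem_some_iff.1 hy
    exact hLt s hs
  · intro s hs
    rcases List.mem_append.1 hs with hs | hs
    · simp only [invWord, List.mem_reverse, List.mem_map] at hs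
      obtain ⟨s, hs', rfl⟩ := hs
      rintro ⟨a, ha⟩
      exact hL.2 s hs' ⟨a⁻¹, by simp [ha]⟩
    · exact (isReducedWord_cons hM ht hMt).2 s hs

theorem IsReducedWord.eq_nil (hinj : ∀ l, Function.Injective (φ l)) {L : List (Σ l, G l)}
    (hL : IsReducedWord φ L) (h : evalWord φ L ∈ (base φ).range) : L = [] := by
  let w : CoprodI.Word G := ⟨L, fun t ht h1 => hL.2 t ht ⟨1, by simp [h1]⟩, hL.1⟩
  have hw : Reduced φ w := fun t ht => hL.2 t ht
  have heq : ofCoprodI w.prod = evalWord φ L := by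
    simp [w, CoprodI.Word.prod, evalWord, map_list_prod, Function.comp_def]
  exact congrArg CoprodI.Word.toList (hw.eq_empty_of_mem_range hinj (heq ▸ h))

theorem not_invWord_append_cons_mem_range (hinj : ∀ l, Function.Injective (φ l))
    {L M : List (Σ l, G l)} {t : Σ l, G l}
    (hL : IsReducedWord φ L) (hM : IsReducedWord φ M) (ht : t.2 ∉ Set.range (φ t.1))
    (hLt : ∀ s ∈ L.head?, s.1 ≠ t.1) (hMt : ∀ s ∈ M.head?, s.1 ≠ t.1) :
    (evalWord φ L)⁻¹ * (of t.1 t.2 * evalWord φ M) ∉ (base φ).range := fun h => by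
  have := (hL.invWord_append_cons hM ht hLt hMt).eq_nil hinj (by simpa using h)
  simp at this

/-- The distances of the letters of a reduced word to the amalgamated subgroup depend only on
the product of the word. -/
theorem IsReducedWord.le_dist_of_evalWord_eq (hinj : ∀ l, Function.Injective (φ l))
    (hd : ∀ l, IsTSIMetric (d l)) {ε : ℝ} {x y : List (Σ l, G l)} {a : A}
    (hx : IsReducedWord φ x) (hy : IsReducedWord φ y)
    (h : evalWord φ x = base φ a * evalWord φ y)
    (hε : ∀ t ∈ y, ∀ b, ε ≤ d t.1 t.2 (φ t.1 b)) :
    ∀ t ∈ x, ∀ b, ε ≤ d t.1 t.2 (φ t.1 b) := by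
  induction x generalizing y a with
  | nil => simp
  | cons s x ih =>
    obtain ⟨k, s⟩ := s
    cases y with
    | nil =>
      have := hx.eq_nil hinj ⟨a, by simp [h]⟩
      simp at this
    | cons t y =>
      obtain ⟨l, t⟩ := t
      have ht : t ∉ Set.range (φ l) := hy.2 _ List.mem_cons_self
      by_cases hkl : k = l
      · subst hkl
        have hz : of (φ := φ) k (s⁻¹ * (φ k a * t)) * evalWord φ y = evalWord φ x := by
          simp only [evalWord_cons, ← of_apply_eq_base φ k] at h
          simp only [map_mul, map_inv, mul_assoc, ← h, inv_mul_cancel_left]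
        by_cases hzA : s⁻¹ * (φ k a * t) ∈ Set.range (φ k)
        · obtain ⟨a', ha'⟩ := hzA
          rw [← ha', of_apply_eq_base] at hz
          have hs : s = φ k a * t * (φ k a')⁻¹ := by rw [ha']; group
          intro r hr b
          rcases List.mem_cons.1 hr with rfl | hr
          · have := hε _ List.mem_cons_self (a⁻¹ * b * a')
            refine this.trans_eq ?_
            obtain ⟨-, -, -, hl, hr⟩ := hd k
            dsimp only
            rw [hs, ← hl (φ k a) t, ← hr (φ k a')⁻¹ (φ k a * t)]
            simp [mul_assoc]
          · exact ih hx.tail hy.tail hz.symm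
              (fun t ht => hε t (List.mem_cons_of_mem _ ht)) r hr b
        · refine (not_invWord_append_cons_mem_range hinj (t := ⟨k, s⁻¹ * (φ k a * t)⟩)
            hx.tail hy.tail hzA hx.head_ne hy.head_ne ⟨1, ?_⟩).elim
          rw [hz]; simp
      · refine (not_invWord_append_cons_mem_range hinj (t := ⟨l, φ l a * t⟩)
          hx hy.tail ?_ (by simpa using hkl) hy.head_ne ⟨1, ?_⟩).elim
        · rintro ⟨b, hb⟩
          exact ht ⟨a⁻¹ * b, by simp [hb]⟩
        · rw [h]
          simp [of_apply_eq_base, mul_assoc]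

variable (φ)

/-- Either a letter from the factor `l` can be brought to the front of a word by cancelling what
precedes it, or the word has a reduced form that does not begin with such a letter. -/
theorem exists_append_cons_or_reduced (Q : List (Σ l, G l)) (l : Λ) :
    (∃ Q₁ z Q₂, Q = Q₁ ++ ⟨l, z⟩ :: Q₂ ∧ evalWord φ Q₁ ∈ (base φ).range) ∨
    ∃ a r, evalWord φ Q = base φ a * evalWord φ r ∧ IsReducedWord φ r ∧
      ∀ t ∈ r.head?, t.1 ≠ l := by
  induction hn : Q.length using Nat.strong_induction_on generalizing Q l with
  | _ n ih =>
  subst hn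
  rcases Q with _ | ⟨⟨k, z⟩, Q⟩
  · exact .inr ⟨1, [], by simp, ⟨by simp, by simp⟩, by simp⟩
  by_cases hkl : k = l
  · subst hkl
    exact .inl ⟨[], z, Q, rfl, 1, by simp⟩
  by_cases hz : z ∈ Set.range (φ k)
  · obtain ⟨b, rfl⟩ := hz
    rcases ih Q.length (by simp) Q l rfl with ⟨Q₁, z', Q₂, rfl, c, hc⟩ | ⟨a, r, hr, hred, hne⟩
    · exact .inl ⟨⟨k, φ k b⟩ :: Q₁, z', Q₂, rfl, b * c, by simp [hc, of_apply_eq_base]⟩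
    · exact .inr ⟨b * a, r, by simp [hr, of_apply_eq_base, mul_assoc], hred, hne⟩
  rcases ih Q.length (by simp) Q k rfl with ⟨Q₁, z', Q₂, rfl, c, hc⟩ | ⟨a, r, hr, hred, hne⟩
  · have heval : ∀ M, evalWord φ (⟨k, z * φ k c * z'⟩ :: M) =
        evalWord φ (⟨k, z⟩ :: (Q₁ ++ ⟨k, z'⟩ :: M)) := by
      intro M
      simp [← hc, of_apply_eq_base, mul_assoc]
    rcases ih (Q₂.length + 1) (by simp) (⟨k, z * φ k c * z'⟩ :: Q₂) l rfl with
      ⟨M₁, y, M₂, hM, hM₁⟩ | ⟨a, r, hr, hred, hne⟩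
    · rcases M₁ with _ | ⟨m, M₁⟩
      · simp only [List.nil_append, List.cons.injEq, Sigma.mk.injEq] at hM
        exact (hkl hM.1.1).elim
      · simp only [List.cons_append, List.cons.injEq] at hM
        obtain ⟨rfl, rfl⟩ := hM
        rw [heval] at hM₁
        exact .inl ⟨_, y, M₂, by simp, hM₁⟩
    · exact .inr ⟨a, r, by rw [← heval, hr], hred, hne⟩
  · refine .inr ⟨1, ⟨k, z * φ k a⟩ :: r, by simp [hr, of_apply_eq_base, mul_assoc], ?_, ?_⟩
    · refine isReducedWord_cons hred ?_ hne
      rintro ⟨b, hb⟩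
      exact hz ⟨b * a⁻¹, by simp [hb]⟩
    · simpa using hkl

/-- In a word with product in the amalgamated subgroup, a letter outside that subgroup is matched
by another letter of the same factor, the product of the letters in between being in the
amalgamated subgroup. -/
theorem exists_matching_letter (hinj : ∀ l, Function.Injective (φ l))
    {P Q : List (Σ l, G l)} {l : Λ} {y : G l} (hy : y ∉ Set.range (φ l))
    (h : evalWord φ (P ++ ⟨l, y⟩ :: Q) = 1) :
    (∃ Q₁ z Q₂, Q = Q₁ ++ ⟨l, z⟩ :: Q₂ ∧ evalWord φ Q₁ ∈ (base φ).range) ∨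
    ∃ P₁ z P₂, invWord P = P₁ ++ ⟨l, z⟩ :: P₂ ∧ evalWord φ P₁ ∈ (base φ).range := by
  rcases exists_append_cons_or_reduced φ Q l with hQ | ⟨a, r, hr, hred, hne⟩
  · exact .inl hQ
  rcases exists_append_cons_or_reduced φ (invWord P) l with hP | ⟨b, s, hs, hsred, hsne⟩
  · exact .inr hP
  refine (not_invWord_append_cons_mem_range hinj (t := ⟨l, φ l b⁻¹ * y * φ l a⟩)
    hsred hred ?_ hsne hne ⟨1, ?_⟩).elim
  · rintro ⟨c, hc⟩
    exact hy ⟨b * c * a⁻¹, by simp [hc, mul_assoc]⟩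
  · rw [evalWord_invWord, inv_eq_iff_eq_inv] at hs
    rw [evalWord_append, evalWord_cons, hs, hr] at h
    simpa [of_apply_eq_base, mul_assoc] using h.symm

variable (d) in
/-- The first word of pairs is shorter than the second and represents the same pair of elements at
no greater cost. -/
def Shortens (L' L : List (Σ l, G l × G l)) : Prop :=
  L'.length < L.length ∧ evalWord φ (fstWord L') = evalWord φ (fstWord L) ∧
    evalWord φ (sndWord L') = evalWord φ (sndWord L) ∧ cost d L' ≤ cost d L

variable {φ}

theorem Shortens.of_invWord (hd : ∀ l, IsTSIMetric (d l)) {L' L : List (Σ l, G l × G l)}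
    (h : Shortens d φ L' (invWord L)) : Shortens d φ (invWord L') L := by
  obtain ⟨h1, h2, h3, h4⟩ := h
  refine ⟨by simpa using h1, ?_, ?_, ?_⟩
  · rw [fstWord_invWord, evalWord_invWord, h2, fstWord_invWord, evalWord_invWord, inv_inv]
  · rw [sndWord_invWord, evalWord_invWord, h3, sndWord_invWord, evalWord_invWord, inv_inv]
  · rwa [cost_invWord hd, ← cost_invWord hd L]

theorem shortens_merge_same (hd : ∀ l, IsTSIMetric (d l)) (P Q : List (Σ l, G l × G l)) {l : Λ}
    (x y : G l × G l) : Shortens d φ (P ++ ⟨l, x * y⟩ :: Q) (P ++ ⟨l, x⟩ :: ⟨l, y⟩ :: Q) := by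
  refine ⟨by simp, by simp [fstWord, mul_assoc], by simp [sndWord, mul_assoc], ?_⟩
  have := (hd l).mul_le x.1 y.1 x.2 y.2
  simp only [cost_append, cost_cons, Prod.fst_mul, Prod.snd_mul]
  linarith

theorem shortens_merge_base (hd : ∀ l, IsTSIMetric (d l))
    (hagree : ∀ (l₁ l₂ : Λ) (a a' : A), d l₁ (φ l₁ a) (φ l₁ a') = d l₂ (φ l₂ a) (φ l₂ a'))
    (P Q : List (Σ l, G l × G l)) (l : Λ) (a b : A) (s : Σ l, G l × G l) :
    Shortens d φ (P ++ ⟨s.1, (φ s.1 a, φ s.1 b) * s.2⟩ :: Q)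
      (P ++ ⟨l, (φ l a, φ l b)⟩ :: s :: Q) := by
  refine ⟨by simp, by simp [fstWord, mul_assoc, of_apply_eq_base],
    by simp [sndWord, mul_assoc, of_apply_eq_base], ?_⟩
  have := (hd s.1).mul_le (φ s.1 a) s.2.1 (φ s.1 b) s.2.2
  simp only [cost_append, cost_cons, Prod.fst_mul, Prod.snd_mul]
  linarith [hagree l s.1 a b]

theorem exists_base_mul (hd : ∀ l, IsTSIMetric (d l)) (a : A) {Q : List (Σ l, G l × G l)}
    (hQ : Q ≠ []) : ∃ Q', Q'.length = Q.length ∧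
      evalWord φ (fstWord Q') = base φ a * evalWord φ (fstWord Q) ∧
      evalWord φ (sndWord Q') = base φ a * evalWord φ (sndWord Q) ∧ cost d Q' = cost d Q := by
  rcases Q with _ | ⟨t, Q⟩
  · exact (hQ rfl).elim
  obtain ⟨-, -, -, hl, -⟩ := hd t.1
  exact ⟨⟨t.1, (φ t.1 a, φ t.1 a) * t.2⟩ :: Q, by simp,
    by simp [fstWord, mul_assoc, of_apply_eq_base],
    by simp [sndWord, mul_assoc, of_apply_eq_base], by simp [hl]⟩

theorem exists_shortens_of_matching (hd : ∀ l, IsTSIMetric (d l))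
    (P Q₁ Q₂ : List (Σ l, G l × G l)) (l : Λ) (a : A) (y : G l) (z : G l × G l)
    (h : evalWord φ (sndWord Q₁) ∈ (base φ).range) :
    ∃ L', Shortens d φ L' (P ++ ⟨l, (φ l a, y)⟩ :: (Q₁ ++ ⟨l, z⟩ :: Q₂)) := by
  obtain ⟨b, hb⟩ := h
  obtain ⟨Q', hlen, hU, hV, hcost⟩ := exists_base_mul (φ := φ) hd a
    (Q := Q₁ ++ ⟨l, (z.1, (φ l b)⁻¹ * ((φ l a)⁻¹ * y) * φ l b * z.2)⟩ :: Q₂) (by simp)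
  refine ⟨P ++ Q', by simp [hlen], ?_, ?_, ?_⟩
  · simp only [fstWord, List.map_append, evalWord_append, List.map_cons, evalWord_cons] at hU ⊢
    simp [hU, of_apply_eq_base]
  · simp only [sndWord, List.map_append, evalWord_append, List.map_cons, evalWord_cons] at hV hb ⊢
    simp [hV, ← hb, of_apply_eq_base, mul_assoc]
  · simp only [cost_append, cost_cons, hcost]
    have h1 : d l (1 * z.1) ((φ l b)⁻¹ * ((φ l a)⁻¹ * y) * φ l b * z.2) ≤
        d l (φ l a) y + d l z.1 z.2 := by
      refine ((hd l).mul_le _ _ _ _).trans_eq ?_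
      obtain ⟨-, -, -, hl, hr⟩ := hd l
      rw [← hl (φ l b), ← hr (φ l b)⁻¹, ← hl (φ l a)]
      simp [mul_assoc]
    rw [one_mul] at h1
    linarith

theorem exists_shortens_of_matching_right (hd : ∀ l, IsTSIMetric (d l))
    (P Q : List (Σ l, G l × G l)) (l : Λ) (a : A) (y : G l)
    (h : ∃ Q₁ z Q₂, sndWord Q = Q₁ ++ ⟨l, z⟩ :: Q₂ ∧ evalWord φ Q₁ ∈ (base φ).range) :
    ∃ L', Shortens d φ L' (P ++ ⟨l, (φ l a, y)⟩ :: Q) := by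
  obtain ⟨R₁, z, R₂, hQ, hR⟩ := h
  obtain ⟨Q₁, M, rfl, rfl, hM⟩ := List.map_eq_append_iff.1 hQ
  obtain ⟨⟨k, t⟩, Q₂, rfl, ht, rfl⟩ := List.map_eq_cons_iff.1 hM
  simp only [Sigma.mk.injEq] at ht
  obtain ⟨rfl, -⟩ := ht
  exact exists_shortens_of_matching hd P Q₁ Q₂ k a y t hR

/-- A word of pairs in which some first component lies in the amalgamated subgroup can be
shortened. -/
theorem exists_shortens_of_mem_range (hinj : ∀ l, Function.Injective (φ l))
    (hd : ∀ l, IsTSIMetric (d l))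
    (hagree : ∀ (l₁ l₂ : Λ) (a a' : A), d l₁ (φ l₁ a) (φ l₁ a') = d l₂ (φ l₂ a) (φ l₂ a'))
    (P Q : List (Σ l, G l × G l)) (l : Λ) (a : A) (y : G l) (hPQ : P ≠ [] ∨ Q ≠ [])
    (h : evalWord φ (sndWord (P ++ ⟨l, (φ l a, y)⟩ :: Q)) = 1) :
    ∃ L', Shortens d φ L' (P ++ ⟨l, (φ l a, y)⟩ :: Q) := by
  have hinv : invWord (P ++ ⟨l, (φ l a, y)⟩ :: Q) =
      invWord Q ++ ⟨l, (φ l a⁻¹, y⁻¹)⟩ :: invWord P := by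
    simp [invWord]
  by_cases hy : y ∈ Set.range (φ l)
  · obtain ⟨b, rfl⟩ := hy
    rcases Q with _ | ⟨s, Q⟩
    · have hP : invWord P ≠ [] := by
        rw [← List.length_pos_iff_ne_nil, length_invWord, List.length_pos_iff_ne_nil]
        simpa using hPQ
      obtain ⟨s, P', hP'⟩ := List.exists_cons_of_ne_nil hP
      have hmerge := shortens_merge_base hd hagree (invWord []) P' l a⁻¹ b⁻¹ s
      rw [map_inv (φ l) b, ← hP', ← hinv] at hmerge
      exact ⟨_, hmerge.of_invWord hd⟩
    · exact ⟨_, shortens_merge_base hd hagree P Q l a b s⟩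
  · have h' : evalWord φ (sndWord P ++ ⟨l, y⟩ :: sndWord Q) = 1 := by
      simpa [sndWord] using h
    rcases exists_matching_letter φ hinj hy h' with hQ | hP
    · exact exists_shortens_of_matching_right hd P Q l a y hQ
    · rw [← sndWord_invWord] at hP
      obtain ⟨L', hL'⟩ := exists_shortens_of_matching_right (φ := φ) hd (invWord Q) (invWord P)
        l a⁻¹ y⁻¹ hP
      exact ⟨_, Shortens.of_invWord hd (hinv ▸ hL')⟩

variable (φ)

theorem le_cost_of_evalWord_eq (hd : ∀ l, IsTSIMetric (d l))
    (hinj : ∀ l, Function.Injective (φ l))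
    (hagree : ∀ (l₁ l₂ : Λ) (a a' : A), d l₁ (φ l₁ a) (φ l₁ a') = d l₂ (φ l₂ a) (φ l₂ a'))
    {w : List (Σ l, G l)} (hw : IsReducedWord φ w) (hne : w ≠ []) {ε : ℝ}
    (hε : ∀ t ∈ w, ∀ a, ε ≤ d t.1 t.2 (φ t.1 a)) (L : List (Σ l, G l × G l))
    (hU : evalWord φ (fstWord L) = evalWord φ w) (hV : evalWord φ (sndWord L) = 1) :
    ε ≤ cost d L := by
  induction hn : L.length using Nat.strong_induction_on generalizing L with
  | _ n ih =>
  subst hn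
  have step : ∀ L', Shortens d φ L' L → ε ≤ cost d L := fun L' ⟨h1, h2, h3, h4⟩ =>
    (ih _ h1 L' (h2.trans hU) (h3.trans hV) rfl).trans h4
  by_cases hA : ∃ t ∈ L, t.2.1 ∈ Set.range (φ t.1)
  · obtain ⟨⟨l, u, y⟩, ht, a, ha⟩ := hA
    obtain rfl : φ l a = u := ha
    obtain ⟨P, Q, rfl⟩ := List.append_of_mem ht
    by_cases hPQ : P ≠ [] ∨ Q ≠ []
    · obtain ⟨L', hL'⟩ := exists_shortens_of_mem_range hinj hd hagree P Q l a y hPQ hV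
      exact step L' hL'
    · push Not at hPQ
      obtain ⟨rfl, rfl⟩ := hPQ
      refine (hne (hw.eq_nil hinj ⟨a, ?_⟩)).elim
      rw [← hU]
      simp [fstWord, of_apply_eq_base]
  push Not at hA
  by_cases hc : L.IsChain (fun s t => s.1 ≠ t.1)
  · have hred : IsReducedWord φ (fstWord L) :=
      ⟨by rw [fstWord, List.isChain_map]; exact hc, List.forall_mem_map.2 hA⟩
    have hdist := hred.le_dist_of_evalWord_eq hinj hd hw (a := 1) (by simpa using hU) hε
    by_cases hB : ∃ t ∈ L, t.2.2 ∈ Set.range (φ t.1)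
    · obtain ⟨t, ht, a, ha⟩ := hB
      have := hdist ⟨t.1, t.2.1⟩ (List.mem_map_of_mem ht) a
      rw [ha] at this
      exact this.trans (le_cost_of_mem hd ht)
    · push Not at hB
      have hred' : IsReducedWord φ (sndWord L) :=
        ⟨by rw [sndWord, List.isChain_map]; exact hc, List.forall_mem_map.2 hB⟩
      have hL : L = [] := List.map_eq_nil_iff.1 (hred'.eq_nil hinj ⟨1, by simp [hV]⟩)
      subst hL
      exact (hne (hw.eq_nil hinj ⟨1, by simp [← hU, fstWord]⟩)).elim
  · rw [List.isChain_iff_forall_rel_of_append_cons_cons] at hc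
    push Not at hc
    obtain ⟨⟨k, x⟩, ⟨l, y⟩, P, Q, rfl, rfl⟩ := hc
    exact step _ (shortens_merge_same hd P Q x y)

variable (d)

/-- The costs of the words of pairs whose first components multiply to `x` and whose second
components multiply to `1`. -/
def graevCosts (x : PushoutI φ) : Set ℝ :=
  {c | ∃ L, evalWord φ (fstWord L) = x ∧ evalWord φ (sndWord L) = 1 ∧ cost d L = c}

variable {d}

theorem bddBelow_graevCosts (hd : ∀ l, IsTSIMetric (d l)) (x : PushoutI φ) :
    BddBelow (graevCosts d φ x) :=
  ⟨0, by rintro _ ⟨L, -, -, rfl⟩; exact cost_nonneg hd L⟩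

variable (d) in
theorem graevCosts_nonempty [Nonempty Λ] (x : PushoutI φ) : (graevCosts d φ x).Nonempty := by
  obtain ⟨L, rfl⟩ := exists_evalWord_eq φ x
  refine ⟨_, L.map fun t => ⟨t.1, (t.2, 1)⟩, ?_, ?_, rfl⟩
  · simp [fstWord, Function.comp_def]
  · simp [sndWord, evalWord, Function.comp_def]

theorem graevCosts_inv (hd : ∀ l, IsTSIMetric (d l)) (x : PushoutI φ) :
    graevCosts d φ x⁻¹ = graevCosts d φ x := by
  have key : ∀ x, graevCosts d φ x ⊆ graevCosts d φ x⁻¹ := by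
    rintro _ _ ⟨L, rfl, h, rfl⟩
    exact ⟨invWord L, by simp [fstWord_invWord], by simp [sndWord_invWord, h],
      cost_invWord hd L⟩
  exact ((key x⁻¹).trans_eq (by rw [inv_inv])).antisymm (key x)

theorem graevCosts_conj [Nonempty Λ] (hd : ∀ l, IsTSIMetric (d l)) (p x : PushoutI φ) :
    graevCosts d φ (p * x * p⁻¹) = graevCosts d φ x := by
  have key : ∀ p x, graevCosts d φ x ⊆ graevCosts d φ (p * x * p⁻¹) := by
    rintro p _ _ ⟨L, rfl, h, rfl⟩
    obtain ⟨P, rfl⟩ := exists_evalWord_eq φ p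
    let D : List (Σ l, G l × G l) := P.map fun t => ⟨t.1, (t.2, t.2)⟩
    have hf : fstWord D = P := by simp [fstWord, D, Function.comp_def]
    have hs : sndWord D = P := by simp [sndWord, D, Function.comp_def]
    have hc : cost d D = 0 := by
      simp [cost, D, Function.comp_def, ((hd _).1 _ _).2]
    refine ⟨D ++ L ++ invWord D, ?_, ?_, by simp [cost_invWord hd, hc]⟩
    · have := fstWord_invWord D
      simp only [fstWord, List.map_append] at hf this ⊢
      simp [hf, this, mul_assoc]
    · have := sndWord_invWord D
      simp only [sndWord, List.map_append] at hs h this ⊢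
      simp [hs, this, h]
  refine Set.Subset.antisymm ?_ (key p x)
  simpa [mul_assoc] using key p⁻¹ (p * x * p⁻¹)

theorem sInf_graevCosts_mul_le [Nonempty Λ] (hd : ∀ l, IsTSIMetric (d l)) (x y : PushoutI φ) :
    sInf (graevCosts d φ (x * y)) ≤ sInf (graevCosts d φ x) + sInf (graevCosts d φ y) := by
  refine le_of_forall_pos_le_add fun η hη => ?_
  obtain ⟨_, ⟨L, rfl, hL, rfl⟩, hL'⟩ :=
    Real.lt_sInf_add_pos (graevCosts_nonempty d φ x) (half_pos hη)
  obtain ⟨_, ⟨M, rfl, hM, rfl⟩, hM'⟩ :=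
    Real.lt_sInf_add_pos (graevCosts_nonempty d φ y) (half_pos hη)
  refine (csInf_le (bddBelow_graevCosts φ hd _) ⟨L ++ M, ?_, ?_, cost_append L M⟩).trans
    (by linarith)
  · simp [fstWord]
  · simp only [sndWord, List.map_append, evalWord_append] at hL hM ⊢
    simp [hL, hM]

theorem sInf_graevCosts_one (hd : ∀ l, IsTSIMetric (d l)) : sInf (graevCosts d φ 1) = 0 :=
  le_antisymm (csInf_le (bddBelow_graevCosts φ hd _) ⟨[], by simp [fstWord], by simp [sndWord],
    rfl⟩) (Real.sInf_nonneg (by rintro _ ⟨L, -, -, rfl⟩; exact cost_nonneg hd L))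

theorem sInf_graevCosts_of_le (hd : ∀ l, IsTSIMetric (d l)) {l : Λ} (g h : G l) :
    sInf (graevCosts d φ (of l g * (of l h)⁻¹)) ≤ d l g h := by
  refine csInf_le (bddBelow_graevCosts φ hd _)
    ⟨[⟨l, (g * h⁻¹, 1)⟩], by simp [fstWord], by simp [sndWord], ?_⟩
  obtain ⟨-, -, -, -, hr⟩ := hd l
  simp [cost, ← hr h⁻¹ g h]

/-- The pseudometric given by the infimal cost is at most any maximal metric extending the
amalgam metric. -/
theorem graevDist_le [Nonempty Λ] (hd : ∀ l, IsTSIMetric (d l))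
    {dbar : PushoutI φ → PushoutI φ → ℝ}
    (hdbar : IsTSIMetric dbar) (hext : ExtendsAmalgamMetric φ d dbar)
    (hmax : ∀ δ : PushoutI φ → PushoutI φ → ℝ,
      IsTSIMetric δ → ExtendsAmalgamMetric φ d δ → ∀ x y, δ x y ≤ dbar x y)
    (x y : PushoutI φ) : sInf (graevCosts d φ (x * y⁻¹)) ≤ dbar x y := by
  let ρ : PushoutI φ → PushoutI φ → ℝ := fun x y => sInf (graevCosts d φ (x * y⁻¹))
  have htri : ∀ x y z, ρ x z ≤ ρ x y + ρ y z := fun x y z => by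
    simpa [ρ, mul_assoc] using sInf_graevCosts_mul_le φ hd (x * y⁻¹) (y * z⁻¹)
  have hof : ∀ l (g h : G l), ρ (of l g) (of l h) ≤ d l g h :=
    fun l g h => sInf_graevCosts_of_le φ hd g h
  refine (le_max_right (dbar x y) (ρ x y)).trans
    (hmax (fun x y => max (dbar x y) (ρ x y)) ⟨?_, ?_, ?_, ?_, ?_⟩ ⟨?_, ?_⟩ x y)
  · intro x y
    constructor
    · intro h
      exact (hdbar.1 x y).1 (le_antisymm (h ▸ le_max_left _ _) (hdbar.nonneg_s4 x y))
    · rintro rfl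
      simp [ρ, (hdbar.1 x x).2 rfl, sInf_graevCosts_one φ hd]
  · intro x y
    have : ρ x y = ρ y x := by
      simp only [ρ]
      rw [← graevCosts_inv φ hd (x * y⁻¹), mul_inv_rev, inv_inv]
    dsimp only
    rw [this, hdbar.2.1 x y]
  · intro x y z
    exact max_le ((hdbar.2.2.1 x y z).trans (add_le_add (le_max_left _ _) (le_max_left _ _)))
      ((htri x y z).trans (add_le_add (le_max_right _ _) (le_max_right _ _)))
  · intro g x y
    have : ρ (g * x) (g * y) = ρ x y := by
      simp only [ρ]
      rw [← graevCosts_conj φ hd g (x * y⁻¹)]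
      simp [mul_assoc]
    dsimp only
    rw [this, hdbar.2.2.2.1]
  · intro g x y
    have : ρ (x * g) (y * g) = ρ x y := by simp [ρ]
    dsimp only
    rw [this, hdbar.2.2.2.2]
  · intro l g h
    dsimp only
    rw [hext.1]
    exact max_eq_left (hof l g h)
  · intro l₁ l₂ hne g₁ g₂
    dsimp only
    rw [hext.2 l₁ l₂ hne]
    refine max_eq_left (le_ciInf fun a => ?_)
    refine (htri _ (of l₁ (φ l₁ a)) _).trans (add_le_add (hof _ _ _) ?_)
    rw [of_apply_eq_base, ← of_apply_eq_base φ l₂]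
    exact hof _ _ _

end GraevNorm

/-- Lower bound for the Graev norm of a reduced word: if `g₁ ⋯ g_n` is a reduced word in the
amalgam (consecutive letters from distinct factors, no letter in the amalgamated subgroup), then
its Graev distance to the identity is at least the minimum over `i` of the distance from `g i`
to the amalgamated subgroup. -/
theorem graev_norm_lower_bound {Λ : Type*} [Nonempty Λ] {G : Λ → Type*} [∀ l, Group (G l)]
    (d : ∀ l, G l → G l → ℝ) (hd : ∀ l, IsTSIMetric (d l))
    {A : Type*} [Group A] (φ : ∀ l, A →* G l)
    (hinj : ∀ l, Function.Injective (φ l))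
    (hclosed : ∀ l, IsDClosed (d l) (Set.range (φ l)))
    (hagree : ∀ (l₁ l₂ : Λ) (a a' : A), d l₁ (φ l₁ a) (φ l₁ a') = d l₂ (φ l₂ a) (φ l₂ a'))
    (dbar : Monoid.PushoutI φ → Monoid.PushoutI φ → ℝ)
    (hdbar : IsTSIMetric dbar) (hext : ExtendsAmalgamMetric φ d dbar)
    (hmax : ∀ δ : Monoid.PushoutI φ → Monoid.PushoutI φ → ℝ,
      IsTSIMetric δ → ExtendsAmalgamMetric φ d δ →
      ∀ x y : Monoid.PushoutI φ, δ x y ≤ dbar x y)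
    (n : ℕ) (hn : 1 ≤ n) (lam : Fin n → Λ)
    (hadj : ∀ (i : Fin n) (h : (i : ℕ) + 1 < n), lam i ≠ lam ⟨(i : ℕ) + 1, h⟩)
    (g : ∀ i : Fin n, G (lam i))
    (hg : ∀ i : Fin n, g i ∉ Set.range (φ (lam i))) :
    (⨅ i : Fin n, ⨅ a : A, d (lam i) (g i) (φ (lam i) a)) ≤
      dbar (List.ofFn (fun i : Fin n => Monoid.PushoutI.of (φ := φ) (lam i) (g i))).prod 1 := by
  have hle : ∀ (i : Fin n) (a : A),
      (⨅ i : Fin n, ⨅ a : A, d (lam i) (g i) (φ (lam i) a)) ≤ d (lam i) (g i) (φ (lam i) a) :=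
    fun i a => (ciInf_le (Set.finite_range _).bddBelow i).trans
      (ciInf_le ⟨0, by rintro _ ⟨b, rfl⟩; exact (hd _).nonneg_s4 _ _⟩ a)
  generalize (⨅ i : Fin n, ⨅ a : A, d (lam i) (g i) (φ (lam i) a)) = ε at hle ⊢
  let w : List (Σ l, G l) := List.ofFn fun i => ⟨lam i, g i⟩
  have hw : IsReducedWord φ w := by
    refine ⟨List.isChain_iff_getElem.2 fun i hi => ?_, ?_⟩
    · have hi' : i + 1 < n := by simpa [w] using hi
      simpa [w] using hadj ⟨i, by omega⟩ hi'
    · simpa [w, List.forall_mem_ofFn_iff] using hg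
  have hwε : ∀ t ∈ w, ∀ a, ε ≤ d t.1 t.2 (φ t.1 a) := by
    simpa [w, List.forall_mem_ofFn_iff] using hle
  have hne : w ≠ [] := by
    rw [← List.length_pos_iff_ne_nil, List.length_ofFn]
    exact hn
  have hprod : evalWord φ w =
      (List.ofFn (fun i : Fin n => Monoid.PushoutI.of (φ := φ) (lam i) (g i))).prod := by
    simp [evalWord, w, List.map_ofFn, Function.comp_def]
  clear_value w
  rw [← hprod]
  have hN := graevDist_le φ hd hdbar hext hmax (evalWord φ w) 1
  rw [inv_one, mul_one] at hN
  refine le_trans ?_ hN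
  refine le_csInf (graevCosts_nonempty d φ _) ?_
  rintro _ ⟨L, hU, hV, rfl⟩
  exact le_cost_of_evalWord_eq φ hd hinj hagree hw hne hwε L hU hV
end
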